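/- Let X be a locally connected continuum. Then NC*(X) is compact and connected if and only if X is homeomorphic to an arc or to a simple closed curve. -/

import Mathlib

open TopologicalSpace Set

/-- The hyperspace NC*(X) of subcontinua with connected complement, as a subspace
of the hyperspace of nonempty closed (= compact) subsets with the Hausdorff metric. -/
abbrev NCstar (X : Type*) [MetricSpace X] :=
  {A : NonemptyCompacts X // IsConnected (A : Set X) ∧ IsPreconnected ((A : Set X)ᶜ)}

open Filter Topology

section ConnectedSets

variable {X : Type*} [TopologicalSpace X]

/-- If `K` is preconnected and `u`, `v` separate its complement, then `K ∪ v` is preconnected. -/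
theorem IsPreconnected.union_of_compl_subset [PreconnectedSpace X] {K u v : Set X}
    (hK : IsPreconnected K) (hu : IsOpen u) (hv : IsOpen v) (hcov : Kᶜ ⊆ u ∪ v)
    (hdisj : Kᶜ ∩ (u ∩ v) = ∅) : IsPreconnected (K ∪ v) := by
  have key : ∀ p q : Set X, IsOpen p → IsOpen q → K ∪ v ⊆ p ∪ q → (K ∪ v) ∩ (p ∩ q) = ∅ →
      K ⊆ p → K ∪ v ⊆ p ∨ K ∪ v ⊆ q := by
    intro p q hp hq hpq hd hKp
    have h1 : IsClopen (v ∩ q) := by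
      refine ⟨⟨?_⟩, hv.inter hq⟩
      have : (v ∩ q)ᶜ = u ∪ p := by
        ext x
        have h1 := @hcov x
        have h2 := @hpq x
        have h3 := @hKp x
        have h4 := (Set.ext_iff.1 hdisj x)
        have h5 := (Set.ext_iff.1 hd x)
        simp only [mem_compl_iff, mem_inter_iff, mem_union, mem_empty_iff_false] at *
        tauto
      rw [this]; exact hu.union hp
    rcases isClopen_iff.1 h1 with h | h
    · left
      intro x hx
      have h2 := @hpq x hx
      have h3 := @hKp x
      have h5 := (Set.ext_iff.1 h x)
      simp only [mem_inter_iff, mem_union, mem_empty_iff_false] at *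
      tauto
    · right
      intro x hx
      have h5 := (Set.ext_iff.1 h x)
      simp only [mem_inter_iff, mem_univ, iff_true] at h5
      exact h5.2
  rw [isPreconnected_iff_subset_of_disjoint]
  intro p q hp hq hpq hd
  rcases (isPreconnected_iff_subset_of_disjoint.1 hK) p q hp hq (subset_union_left.trans hpq)
    (subset_eq_empty (inter_subset_inter_left _ subset_union_left) hd) with h | h
  · exact key p q hp hq hpq hd h
  · exact (key q p hq hp (by rwa [union_comm q p]) (by rwa [inter_comm q p]) h).symm

/-- In a connected space, the complement of a component of the complement of a
connected set is connected. -/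
theorem isPreconnected_compl_connectedComponentIn_compl [PreconnectedSpace X] {V : Set X}
    (hV : IsPreconnected V) (k : X) : IsPreconnected (connectedComponentIn Vᶜ k)ᶜ := by
  by_cases hk : k ∈ Vᶜ
  swap
  · rw [connectedComponentIn_eq_empty hk, compl_empty]; exact isPreconnected_univ
  set K := connectedComponentIn Vᶜ k with hKdef
  have hKV : K ⊆ Vᶜ := connectedComponentIn_subset _ _
  have hVK : V ⊆ Kᶜ := subset_compl_comm.1 hKV
  have key : ∀ u v : Set X, IsOpen u → IsOpen v → Kᶜ ⊆ u ∪ v → Kᶜ ∩ (u ∩ v) = ∅ → V ⊆ u →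
      Kᶜ ⊆ u := by
    intro u v hu hv hcov hd hVu
    have h1 := isPreconnected_connectedComponentIn.union_of_compl_subset hu hv hcov hd
    have h2 : K ∪ v ⊆ K := by
      refine h1.subset_connectedComponentIn (Or.inl (mem_connectedComponentIn hk)) ?_
      rintro x (hx | hx) hxV
      · exact hKV hx hxV
      · exact (Set.ext_iff.1 hd x).1 ⟨hVK hxV, hVu hxV, hx⟩
    intro x hx
    rcases hcov hx with h | h
    · exact h
    · exact absurd (h2 (Or.inr h)) hx
  rw [isPreconnected_iff_subset_of_disjoint]
  intro u v hu hv hcov hd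
  rcases (isPreconnected_iff_subset_of_disjoint.1 hV) u v hu hv (hVK.trans hcov)
    (subset_eq_empty (inter_subset_inter_left _ hVK) hd) with h | h
  · exact Or.inl (key u v hu hv hcov hd h)
  · exact Or.inr (key v u hv hu (by rwa [union_comm v u]) (by rwa [inter_comm v u]) h)

theorem IsClosed.connectedComponentIn {F : Set X} (hF : IsClosed F) (x : X) :
    IsClosed (connectedComponentIn F x) := by
  by_cases hx : x ∈ F
  · refine closure_subset_iff_isClosed.1 ?_
    exact isPreconnected_connectedComponentIn.closure.subset_connectedComponentIn
      (subset_closure (mem_connectedComponentIn hx))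
      (closure_minimal (connectedComponentIn_subset _ _) hF)
  · rw [connectedComponentIn_eq_empty hx]; exact isClosed_empty

/-- A nonempty open set whose only possible boundary point is a noncut point `x` contains every
point other than `x`. -/
theorem compl_singleton_subset_of_isOpen {x : X} (hx : IsPreconnected ({x}ᶜ : Set X)) {O : Set X}
    (hO : IsOpen O) (hcl : closure O ⊆ O ∪ {x}) (hne : (O \ {x}).Nonempty) : {x}ᶜ ⊆ O := by
  refine hx.subset_of_closure_inter_subset hO ?_ ?_
  · obtain ⟨y, hy, hyx⟩ := hne
    exact ⟨y, hyx, hy⟩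
  · rintro y ⟨hy, hyx⟩
    exact (hcl hy).resolve_right hyx

/-- A nested intersection of continua is a continuum. -/
theorem isConnected_sInter_of_isChain [CompactSpace X] [T2Space X] {c : Set (Set X)}
    (hc : IsChain (· ⊆ ·) c) (hne : c.Nonempty) (hcl : ∀ A ∈ c, IsClosed A)
    (hconn : ∀ A ∈ c, IsConnected A) : IsConnected (⋂₀ c) := by
  have : Nonempty c := hne.to_subtype
  have hdir : DirectedOn (· ⊇ ·) c := by
    intro A hA B hB
    rcases hc.total hA hB with h | h
    · exact ⟨A, hA, subset_rfl, h⟩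
    · exact ⟨B, hB, h, subset_rfl⟩
  refine ⟨IsCompact.nonempty_sInter_of_directed_nonempty_isCompact_isClosed hdir
    (fun A hA => (hconn A hA).nonempty) (fun A hA => (hcl A hA).isCompact) hcl, ?_⟩
  have hS : IsClosed (⋂₀ c) := isClosed_sInter hcl
  rw [isPreconnected_iff_subset_of_disjoint_closed]
  intro u v hu hv hcov hd
  obtain ⟨U, V, hU, hV, hUu, hVv, hUV⟩ := SeparatedNhds.of_isCompact_isCompact
    (hS.inter hu).isCompact (hS.inter hv).isCompact (by
      rw [Set.disjoint_left]
      rintro x ⟨hx, hxu⟩ ⟨-, hxv⟩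
      exact (Set.ext_iff.1 hd x).1 ⟨hx, hxu, hxv⟩)
  obtain ⟨⟨A, hA⟩, hAUV⟩ := exists_subset_nhds_of_isCompact' (V := fun A : c => (A : Set X))
    hdir.directed_val (fun A => (hcl A A.2).isCompact) (fun A => hcl A A.2) (U := U ∪ V) (by
      intro x hx
      refine (hU.union hV).mem_nhds ?_
      have hx' : x ∈ ⋂₀ c := by simpa using hx
      rcases hcov hx' with h | h
      · exact Or.inl (hUu ⟨hx', h⟩)
      · exact Or.inr (hVv ⟨hx', h⟩))
  rcases (hconn A hA).isPreconnected.subset_or_subset hU hV hUV hAUV with h | h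
  · left
    intro x hx
    rcases hcov hx with h' | h'
    · exact h'
    · exact absurd (hVv ⟨hx, h'⟩) (Set.disjoint_left.1 hUV (h (hx A hA)))
  · right
    intro x hx
    rcases hcov hx with h' | h'
    · exact absurd (h (hx A hA)) (Set.disjoint_left.1 hUV (hUu ⟨hx, h'⟩))
    · exact h'

/-- In a compact connected Hausdorff space, every proper subcontinuum is properly contained in a
larger proper subcontinuum. -/
theorem exists_isConnected_ssubset [CompactSpace X] [T2Space X] [PreconnectedSpace X] {K : Set X}
    (hK : IsConnected K) (hKc : IsClosed K) (hKu : K ≠ univ) :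
    ∃ L, IsConnected L ∧ IsClosed L ∧ K ⊂ L ∧ L ≠ univ := by
  obtain ⟨z, hz⟩ := (ne_univ_iff_exists_notMem K).1 hKu
  obtain ⟨k, hk⟩ := hK.nonempty
  obtain ⟨N, M, hN, hM, hzN, hKM, hNM⟩ := SeparatedNhds.of_isCompact_isCompact
    (isCompact_singleton (x := z)) hKc.isCompact (by simpa using hz)
  rw [singleton_subset_iff] at hzN
  have hMN : M ⊆ Nᶜ := fun x hx hxN => Set.disjoint_left.1 hNM hxN hx
  have hkN : k ∈ Nᶜ := hMN (hKM hk)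
  refine ⟨connectedComponentIn Nᶜ k, isConnected_connectedComponentIn_iff.2 hkN,
    hN.isClosed_compl.connectedComponentIn k, ?_, ?_⟩
  · have hsub := hK.isPreconnected.subset_connectedComponentIn hk (hKM.trans hMN)
    refine hsub.ssubset_of_ne fun heq => ?_
    have : CompactSpace ↥(Nᶜ) := isCompact_iff_compactSpace.1 hN.isClosed_compl.isCompact
    have hcomp : connectedComponent (⟨k, hkN⟩ : ↥(Nᶜ)) ⊆ ((↑) : ↥(Nᶜ) → X) ⁻¹' M := by
      intro x hx
      refine hKM ?_
      rw [heq, connectedComponentIn_eq_image hkN]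
      exact ⟨x, hx, rfl⟩
    rw [connectedComponent_eq_iInter_isClopen] at hcomp
    have hne : Nonempty { s : Set ↥(Nᶜ) // IsClopen s ∧ (⟨k, hkN⟩ : ↥(Nᶜ)) ∈ s } :=
      ⟨⟨univ, isClopen_univ, mem_univ _⟩⟩
    obtain ⟨⟨S, hS, hkS⟩, hSM⟩ := exists_subset_nhds_of_isCompact'
      (V := fun s : { s : Set ↥(Nᶜ) // IsClopen s ∧ (⟨k, hkN⟩ : ↥(Nᶜ)) ∈ s } => s.1)
      (fun s t => ⟨⟨s.1 ∩ t.1, s.2.1.inter t.2.1, s.2.2, t.2.2⟩, inter_subset_left,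
        inter_subset_right⟩) (fun s => s.2.1.isClosed.isCompact) (fun s => s.2.1.isClosed)
      (U := ((↑) : ↥(Nᶜ) → X) ⁻¹' M)
      (fun x hx => (hM.preimage continuous_subtype_val).mem_nhds (hcomp hx))
    have hclosed : IsClosed (((↑) : ↥(Nᶜ) → X) '' S) :=
      hN.isClosed_compl.isClosedMap_subtype_val _ hS.isClosed
    have hopen : IsOpen (((↑) : ↥(Nᶜ) → X) '' S) := by
      obtain ⟨O, hO, rfl⟩ := isOpen_induced_iff.1 hS.isOpen
      have : (((↑) : ↥(Nᶜ) → X) '' ((↑) ⁻¹' O)) = O ∩ M := by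
        ext x
        constructor
        · rintro ⟨y, hy, rfl⟩
          exact ⟨hy, hSM hy⟩
        · rintro ⟨hxO, hxM⟩
          exact ⟨⟨x, hMN hxM⟩, hxO, rfl⟩
      rw [this]
      exact hO.inter hM
    rcases isClopen_iff.1 ⟨hclosed, hopen⟩ with h | h
    · exact (Set.ext_iff.1 h k).1 ⟨_, hkS, rfl⟩
    · obtain ⟨y, -, hy⟩ := (Set.ext_iff.1 h z).2 (mem_univ z)
      exact y.2 (hy ▸ hzN)
  · intro h
    exact (connectedComponentIn_subset Nᶜ k (h ▸ mem_univ z) : z ∈ Nᶜ) hzN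

/-- Every compact subset of a connected open set of a locally connected compact Hausdorff space
lies in a subcontinuum of that open set. -/
theorem IsPreconnected.exists_isConnected_between [CompactSpace X] [T2Space X]
    [LocallyConnectedSpace X] {U C : Set X} (hU : IsPreconnected U) (hUo : IsOpen U)
    (hne : U.Nonempty) (hC : IsCompact C) (hCU : C ⊆ U) :
    ∃ M, IsConnected M ∧ IsClosed M ∧ C ⊆ M ∧ M ⊆ U := by
  obtain ⟨x₀, hx₀⟩ := hne
  have hloc : ∀ y ∈ U, ∃ N, IsConnected N ∧ IsClosed N ∧ N ⊆ U ∧ N ∈ 𝓝 y := by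
    intro y hy
    obtain ⟨F, hF, hFc, hFU⟩ := exists_mem_nhds_isClosed_subset (hUo.mem_nhds hy)
    exact ⟨_, isConnected_connectedComponentIn_iff.2 (mem_of_mem_nhds hF),
      hFc.connectedComponentIn y, (connectedComponentIn_subset _ _).trans hFU,
      connectedComponentIn_mem_nhds hF⟩
  let S : Set X := {y | ∃ M, IsConnected M ∧ IsClosed M ∧ M ⊆ U ∧ x₀ ∈ M ∧ M ∈ 𝓝 y}
  have hSo : IsOpen S := by
    rw [isOpen_iff_mem_nhds]
    rintro y ⟨M, h1, h2, h3, h4, h5⟩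
    filter_upwards [eventually_mem_nhds_iff.2 h5] with z hz
    exact ⟨M, h1, h2, h3, h4, hz⟩
  have hUS : U ⊆ S := by
    refine hU.subset_of_closure_inter_subset hSo ⟨x₀, hx₀, ?_⟩ ?_
    · obtain ⟨N, h1, h2, h3, h4⟩ := hloc x₀ hx₀
      exact ⟨N, h1, h2, h3, mem_of_mem_nhds h4, h4⟩
    · rintro y ⟨hy, hyU⟩
      obtain ⟨N, h1, h2, h3, h4⟩ := hloc y hyU
      obtain ⟨z, hzN, M, g1, g2, g3, g4, g5⟩ := mem_closure_iff_nhds.1 hy N h4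
      exact ⟨M ∪ N, g1.union ⟨z, mem_of_mem_nhds g5, hzN⟩ h1, g2.union h2, union_subset g3 h3,
        Or.inl g4, mem_of_superset h4 subset_union_right⟩
  have hUS' : ∀ y ∈ U, ∃ M : Set X, IsConnected M ∧ IsClosed M ∧ M ⊆ U ∧ x₀ ∈ M ∧ M ∈ 𝓝 y :=
    fun y hy => hUS hy
  choose! M h1 h2 h3 h4 h5 using hUS'
  obtain ⟨t, ht, hCt⟩ := hC.elim_nhds_subcover M fun x hx => h5 x (hCU hx)
  have htU : ∀ y ∈ insert x₀ (t : Set X), y ∈ U := by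
    rintro y (rfl | hy)
    · exact hx₀
    · exact hCU (ht y hy)
  refine ⟨⋃ y ∈ insert x₀ (t : Set X), M y, ⟨⟨x₀, mem_biUnion (mem_insert _ _) (h4 x₀ hx₀)⟩, ?_⟩,
    ?_, ?_, ?_⟩
  · rw [← sUnion_image]
    refine isPreconnected_sUnion x₀ _ ?_ ?_
    · rintro _ ⟨y, hy, rfl⟩
      exact h4 y (htU y hy)
    · rintro _ ⟨y, hy, rfl⟩
      exact (h1 y (htU y hy)).isPreconnected
  · exact (t.finite_toSet.insert x₀).isClosed_biUnion fun y hy => h2 y (htU y hy)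
  · exact hCt.trans (biUnion_subset_biUnion_left (subset_insert _ _))
  · exact iUnion₂_subset fun y hy => h3 y (htU y hy)

end ConnectedSets


section Arc

/-- A compact connected metric space with a bounded linear order whose open rays are open is an
arc. -/
theorem exists_homeomorph_unitInterval_of_linearOrder {Y : Type*} [MetricSpace Y] [CompactSpace Y]
    [PreconnectedSpace Y] [LinearOrder Y] (hlt : ∀ x : Y, IsOpen (Iio x))
    (hgt : ∀ x : Y, IsOpen (Ioi x)) {a b : Y} (hab : a < b) (ha : ∀ x, a ≤ x) (hb : ∀ x, x ≤ b) :
    ∃ e : Y ≃ₜ unitInterval, e a = 0 ∧ e b = 1 := by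
  have hd : DenselyOrdered Y := by
    refine ⟨fun x y hxy => ?_⟩
    by_contra! h
    have hcl : IsClopen (Iio y) := by
      refine ⟨⟨?_⟩, hlt y⟩
      have : (Iio y)ᶜ = Ioi x := by
        ext z
        simp only [mem_compl_iff, mem_Iio, not_lt, mem_Ioi]
        exact ⟨fun hz => hxy.trans_le hz, fun hz => h z hz⟩
      rw [this]; exact hgt x
    rcases isClopen_iff.1 hcl with h | h
    · exact (Set.ext_iff.1 h x).1 hxy
    · exact lt_irrefl y ((Set.ext_iff.1 h y).2 (mem_univ y))
  have hct : OrderClosedTopology Y := by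
    refine ⟨⟨isOpen_iff_mem_nhds.2 ?_⟩⟩
    rintro ⟨x, y⟩ hxy
    simp only [mem_compl_iff, mem_ofPred_eq, not_le] at hxy
    obtain ⟨c, hyc, hcx⟩ := exists_between hxy
    filter_upwards [((hgt c).prod (hlt c)).mem_nhds ⟨hcx, hyc⟩]
    rintro ⟨z, w⟩ ⟨hz, hw⟩
    simp only [mem_compl_iff, mem_ofPred_eq, not_le]
    exact lt_trans hw hz
  have hne : Nonempty Y := ⟨a⟩
  let φ : Y → Y → ℝ := fun c w => min 1 (Metric.infDist w (Iic c))
  have hφc : ∀ c, Continuous (φ c) := fun c =>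
    continuous_const.min (Metric.continuous_infDist_pt _)
  have hφ1 : ∀ c w, φ c w ≤ 1 := fun c w => min_le_left _ _
  let h : Y → Y → ℝ := fun c z => sSup ((fun w => φ c (min w z)) '' univ)
  have hbdd : ∀ c z, BddAbove ((fun w => φ c (min w z)) '' univ) := by
    rintro c z
    refine ⟨1, ?_⟩
    rintro _ ⟨w, -, rfl⟩
    exact hφ1 _ _
  have hhc : ∀ c, Continuous (h c) := fun c =>
    isCompact_univ.continuous_sSup (f := fun z w => φ c (min w z))
      ((hφc c).comp (continuous_snd.min continuous_fst))
  have hh0 : ∀ c z, z ≤ c → h c z = 0 := by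
    intro c z hz
    have : (fun w => φ c (min w z)) = fun _ => (0 : ℝ) := by
      ext w
      have : Metric.infDist (min w z) (Iic c) = 0 :=
        Metric.infDist_zero_of_mem ((min_le_right w z).trans hz)
      simp [φ, this]
    simp only [h, this, image_univ, range_const, csSup_singleton]
  have hhpos : ∀ c z, c < z → 0 < h c z := by
    intro c z hz
    have h1 : φ c z ≤ h c z := le_csSup (hbdd c z) ⟨z, mem_univ _, by simp⟩
    refine lt_of_lt_of_le (lt_min one_pos ?_) h1
    exact (isClosed_Iic.notMem_iff_infDist_pos nonempty_Iic).1 (not_le.2 hz)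
  have hh1 : ∀ c z, h c z ≤ 1 := by
    intro c z
    refine csSup_le (image_nonempty.2 univ_nonempty) ?_
    rintro _ ⟨w, -, rfl⟩
    exact hφ1 _ _
  have hhnn : ∀ c z, 0 ≤ h c z := by
    intro c z
    rcases le_or_gt z c with hz | hz
    · exact (hh0 c z hz).ge
    · exact (hhpos c z hz).le
  have hhm : ∀ c, Monotone (h c) := by
    intro c z z' hz
    refine csSup_le_csSup (hbdd c z') (image_nonempty.2 univ_nonempty) ?_
    rintro _ ⟨w, -, rfl⟩
    refine ⟨min w z, mem_univ _, ?_⟩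
    simp only [min_assoc, min_eq_left hz]
  let f : Y → ℝ := fun z => ∑' n : ℕ, (1 / 2 : ℝ) ^ n * h (denseSeq Y n) z
  have hbound : ∀ n z, ‖(1 / 2 : ℝ) ^ n * h (denseSeq Y n) z‖ ≤ (1 / 2 : ℝ) ^ n := by
    intro n z
    rw [Real.norm_of_nonneg (mul_nonneg (by positivity) (hhnn _ _))]
    exact mul_le_of_le_one_right (by positivity) (hh1 _ _)
  have hsum : ∀ z, Summable fun n : ℕ => (1 / 2 : ℝ) ^ n * h (denseSeq Y n) z := fun z =>
    Summable.of_norm_bounded summable_geometric_two fun n => hbound n z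
  have hfc : Continuous f :=
    continuous_tsum (fun n => continuous_const.mul (hhc _)) summable_geometric_two hbound
  have hfm : StrictMono f := by
    intro x y hxy
    obtain ⟨n, hxn, hny⟩ : ∃ n, denseSeq Y n ∈ Ioi x ∩ Iio y := by
      obtain ⟨_, hc, n, rfl⟩ := (denseRange_denseSeq Y).inter_open_nonempty _
        ((hgt x).inter (hlt y)) (exists_between hxy)
      exact ⟨n, hc⟩
    refine Summable.tsum_lt_tsum (i := n)
      (fun m => mul_le_mul_of_nonneg_left (hhm _ hxy.le) (by positivity)) ?_ (hsum x) (hsum y)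
    refine mul_lt_mul_of_pos_left ?_ (by positivity)
    rw [hh0 _ _ (le_of_lt hxn)]
    exact hhpos _ _ hny
  have hpos : 0 < f b - f a := sub_pos.2 (hfm hab)
  let g : Y → unitInterval := fun z => ⟨(f z - f a) / (f b - f a),
    div_nonneg (sub_nonneg.2 (hfm.monotone (ha z))) hpos.le,
    (div_le_one hpos).2 (sub_le_sub_right (hfm.monotone (hb z)) _)⟩
  have hgc : Continuous g := ((hfc.sub continuous_const).div_const _).subtype_mk _
  have hga : g a = 0 := by ext; simp [g]
  have hgb : g b = 1 := by ext; simp [g, hpos.ne']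
  have hgi : Function.Injective g := by
    intro x y hxy
    have h1 := congrArg Subtype.val hxy
    simp only [g] at h1
    have h2 := (div_left_inj' hpos.ne').1 h1
    exact hfm.injective (by linarith)
  have hgs : Function.Surjective g := fun t =>
    mem_range_of_exists_le_of_exists_ge hgc ⟨a, hga ▸ t.2.1⟩ ⟨b, hgb ▸ t.2.2⟩
  exact ⟨hgc.homeoOfEquivCompactToT2 (f := Equiv.ofBijective g ⟨hgi, hgs⟩), hga, hgb⟩

/-- A metric continuum in which any point other than `a` and `b` separates `a` from `b` is an arc
with endpoints `a` and `b`. -/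
theorem exists_homeomorph_unitInterval_of_separates {Y : Type*} [MetricSpace Y] [CompactSpace Y]
    [PreconnectedSpace Y] {a b : Y} (hab : a ≠ b)
    (hsep : ∀ x, x ≠ a → x ≠ b → ∃ G H : Set Y, IsOpen G ∧ IsOpen H ∧ a ∈ G ∧ b ∈ H ∧
      Disjoint G H ∧ G ∪ H = {x}ᶜ) :
    ∃ e : Y ≃ₜ unitInterval, e a = 0 ∧ e b = 1 := by
  have hPQ : ∀ x, ∃ P Q : Set Y, IsOpen P ∧ IsOpen Q ∧ (x = a ∨ a ∈ P) ∧ (x = b ∨ b ∈ Q) ∧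
      Disjoint P Q ∧ P ∪ Q = {x}ᶜ := by
    intro x
    by_cases hxa : x = a
    · subst hxa
      exact ⟨∅, {x}ᶜ, isOpen_empty, isOpen_compl_singleton, Or.inl rfl, Or.inr hab.symm,
        empty_disjoint _, empty_union _⟩
    by_cases hxb : x = b
    · subst hxb
      exact ⟨{x}ᶜ, ∅, isOpen_compl_singleton, isOpen_empty, Or.inr hab, Or.inl rfl,
        disjoint_empty _, union_empty _⟩
    obtain ⟨G, H, h1, h2, h3, h4, h5, h6⟩ := hsep x hxa hxb
    exact ⟨G, H, h1, h2, Or.inr h3, Or.inr h4, h5, h6⟩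
  choose P Q hP hQ haP hbQ hd hU using hPQ
  have hmem : ∀ x y, y ∈ P x ∨ y ∈ Q x ↔ y ≠ x := fun x y => Set.ext_iff.1 (hU x) y
  have hxP : ∀ x, x ∉ P x := fun x h => (hmem x x).1 (Or.inl h) rfl
  have hxQ : ∀ x, x ∉ Q x := fun x h => (hmem x x).1 (Or.inr h) rfl
  have hnot : ∀ x y, y ∈ P x → y ∉ Q x := fun x y h =>
    Set.disjoint_left.1 (hd x) h
  have hKm : ∀ x, IsPreconnected ({x} ∪ P x) := fun x =>
    isPreconnected_singleton.union_of_compl_subset (hQ x) (hP x)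
      (by rw [union_comm, hU]) (by rw [inter_comm (Q x), (hd x).inter_eq, inter_empty])
  have hKp : ∀ x, IsPreconnected ({x} ∪ Q x) := fun x =>
    isPreconnected_singleton.union_of_compl_subset (hP x) (hQ x)
      (by rw [hU]) (by rw [(hd x).inter_eq, inter_empty])
  have hPsub : ∀ x y, y ∈ P x → {x} ∪ Q x ⊆ Q y := by
    intro x y hy
    have hyx : y ∉ {x} ∪ Q x := by
      rintro (h | h)
      · rw [mem_singleton_iff] at h
        exact hxP x (h ▸ hy)
      · exact hnot x y hy h
    have hb : b ∈ {x} ∪ Q x := (hbQ x).imp Eq.symm id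
    refine (hKp x).subset_right_of_subset_union (hP y) (hQ y) (hd y) ?_
      ⟨b, hb, (hbQ y).resolve_left fun h => hyx (h ▸ hb)⟩
    intro z hz
    exact (hmem y z).2 fun h => hyx (h ▸ hz)
  have hQsub : ∀ x y, y ∈ Q x → {x} ∪ P x ⊆ P y := by
    intro x y hy
    have hyx : y ∉ {x} ∪ P x := by
      rintro (h | h)
      · rw [mem_singleton_iff] at h
        exact hxQ x (h ▸ hy)
      · exact hnot x y h hy
    have ha : a ∈ {x} ∪ P x := (haP x).imp Eq.symm id
    refine (hKm x).subset_left_of_subset_union (hP y) (hQ y) (hd y) ?_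
      ⟨a, ha, (haP y).resolve_left fun h => hyx (h ▸ ha)⟩
    intro z hz
    exact (hmem y z).2 fun h => hyx (h ▸ hz)
  have hiff : ∀ x y, y ∈ P x ↔ x ∈ Q y := fun x y =>
    ⟨fun h => hPsub x y h (Or.inl rfl), fun h => hQsub y x h (Or.inl rfl)⟩
  have hsto : IsStrictTotalOrder Y fun x y => x ∈ P y :=
    { trichotomous := fun x y h1 h2 => by
        by_contra hne
        rcases (hmem y x).2 hne with h | h
        · exact h1 h
        · exact h2 ((hiff x y).2 h)
      irrefl := hxP
      trans := fun x y z hxy hyz => hQsub y z ((hiff z y).1 hyz) (Or.inr hxy) }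
  classical
  let _ : LinearOrder Y := linearOrderOfSTO fun x y => x ∈ P y
  have hlt : ∀ x y : Y, x < y ↔ x ∈ P y := fun x y => Iff.rfl
  refine exists_homeomorph_unitInterval_of_linearOrder (fun x => ?_) (fun x => ?_) (a := a) (b := b)
    ?_ (fun x => ?_) (fun x => ?_)
  · exact hP x
  · have : Ioi x = Q x := by
      ext y
      exact hiff y x
    rw [this]
    exact hQ x
  · exact (haP b).resolve_left hab.symm
  · exact le_iff_eq_or_lt.2 ((haP x).imp Eq.symm id)
  · exact le_iff_eq_or_lt.2 ((hbQ x).imp id (hiff b x).2)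

end Arc

section Separation

variable {X : Type*} [TopologicalSpace X]

/-- `A` separates `a` from `b` if it meets every connected set containing `a` and `b`. -/
def Separates (A : Set X) (a b : X) : Prop :=
  ∀ T : Set X, IsPreconnected T → a ∈ T → b ∈ T → (T ∩ A).Nonempty

theorem separates_singleton_iff {x a b : X} :
    Separates {x} a b ↔ ∀ T : Set X, IsPreconnected T → a ∈ T → b ∈ T → x ∈ T := by
  simp only [Separates, inter_singleton_nonempty]

theorem Separates.notMem_connectedComponentIn {x a b : X} (h : Separates {x} a b) :
    b ∉ connectedComponentIn {x}ᶜ a := fun hb => by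
  by_cases hax : a ∈ ({x}ᶜ : Set X)
  · exact connectedComponentIn_subset {x}ᶜ a (separates_singleton_iff.1 h _
      isPreconnected_connectedComponentIn (mem_connectedComponentIn hax) hb) rfl
  · rw [connectedComponentIn_eq_empty hax] at hb
    exact hb

/-- A nonempty subset which is closed and connected and has a connected complement. -/
structure IsNonseparatingContinuum (A : Set X) : Prop where
  isClosed : IsClosed A
  isConnected : IsConnected A
  isPreconnected_compl : IsPreconnected Aᶜ

theorem isPreconnected_union_of_isOpen_of_mem_closure {U N : Set X} {q : X}
    (hU : IsPreconnected U) (hN : IsPreconnected N) (hNo : IsOpen N) (hq : q ∈ N)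
    (hqU : q ∈ closure U) : IsPreconnected (U ∪ N) := by
  obtain ⟨z, hzN, hzU⟩ := mem_closure_iff.1 hqU N hNo hq
  exact hU.union z hzU hzN hN

variable [T2Space X] [ConnectedSpace X] [LocallyConnectedSpace X]

theorem closure_connectedComponentIn_compl_singleton {p c : X} (hc : c ≠ p) :
    closure (connectedComponentIn {p}ᶜ c) = insert p (connectedComponentIn {p}ᶜ c) := by
  have hco : IsOpen (connectedComponentIn {p}ᶜ c) := isOpen_compl_singleton.connectedComponentIn
  have hcc : c ∈ connectedComponentIn {p}ᶜ c := mem_connectedComponentIn hc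
  have hsub : closure (connectedComponentIn {p}ᶜ c) ⊆ insert p (connectedComponentIn {p}ᶜ c) := by
    intro y hy
    by_cases hyp : y = p
    · exact Or.inl hyp
    right
    have h1 : IsPreconnected (insert y (connectedComponentIn {p}ᶜ c)) :=
      isPreconnected_connectedComponentIn.subset_closure (subset_insert _ _)
        (insert_subset hy subset_closure)
    refine h1.subset_connectedComponentIn (Or.inr hcc) (insert_subset hyp ?_) (mem_insert _ _)
    exact connectedComponentIn_subset _ _
  refine hsub.antisymm (insert_subset ?_ subset_closure)
  by_contra hp
  have hcl : IsClosed (connectedComponentIn {p}ᶜ c) :=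
    closure_subset_iff_isClosed.1 fun y hy => (hsub hy).resolve_left fun h => hp (h ▸ hy)
  rcases isClopen_iff.1 ⟨hcl, hco⟩ with h | h
  · exact (Set.ext_iff.1 h c).1 hcc
  · exact connectedComponentIn_subset {p}ᶜ c ((Set.ext_iff.1 h p).2 (mem_univ p)) rfl

variable [CompactSpace X]

/-- Every nonseparating continuum contains a noncut point. -/
theorem IsNonseparatingContinuum.exists_mem_isPreconnected_compl_singleton {A : Set X}
    (hA : IsNonseparatingContinuum A) : ∃ a ∈ A, IsPreconnected ({a}ᶜ : Set X) := by
  obtain ⟨B, hBA, hB⟩ := zorn_superset_nonempty {B : Set X | IsNonseparatingContinuum B} (by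
    intro c hc hch hne
    refine ⟨⋂₀ c, ⟨isClosed_sInter fun B hB => (hc hB).isClosed,
      isConnected_sInter_of_isChain hch hne (fun B hB => (hc hB).isClosed)
        fun B hB => (hc hB).isConnected, ?_⟩, fun B hB => sInter_subset_of_mem hB⟩
    rw [compl_sInter]
    refine IsPreconnected.sUnion_directed ?_ ?_
    · rintro _ ⟨B, hB, rfl⟩ _ ⟨D, hD, rfl⟩
      rcases hch.total hB hD with h | h
      · exact ⟨Bᶜ, ⟨B, hB, rfl⟩, subset_rfl, compl_subset_compl.2 h⟩
      · exact ⟨Dᶜ, ⟨D, hD, rfl⟩, compl_subset_compl.2 h, subset_rfl⟩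
    · rintro _ ⟨B, hB, rfl⟩
      exact (hc hB).isPreconnected_compl) A hA
  have hBn : IsNonseparatingContinuum B := hB.prop
  obtain ⟨q, hq, hqN⟩ : ∃ q ∈ B, ∀ N, IsPreconnected N → IsOpen N → q ∈ N →
      IsPreconnected (Bᶜ ∪ N) := by
    by_cases hcl : ∃ q ∈ B, q ∈ closure Bᶜ
    · obtain ⟨q, hq, hq'⟩ := hcl
      exact ⟨q, hq, fun N h1 h2 h3 =>
        isPreconnected_union_of_isOpen_of_mem_closure hBn.isPreconnected_compl h1 h2 h3 hq'⟩
    · push Not at hcl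
      have hop : IsOpen B := isClosed_compl_iff.1 <| closure_subset_iff_isClosed.1 fun y hy =>
        fun hyB => hcl y hyB hy
      obtain ⟨q, hq⟩ := hBn.isConnected.nonempty
      refine ⟨q, hq, fun N h1 h2 h3 => ?_⟩
      rw [IsClopen.eq_univ ⟨hBn.isClosed, hop⟩ ⟨q, hq⟩, compl_univ, empty_union]
      exact h1
  have hBq : B = {q} := by
    refine Subset.antisymm (fun y hy => ?_) (singleton_subset_iff.2 hq)
    by_contra hyq
    have hqy : q ∈ ({y}ᶜ : Set X) := fun h => hyq h.symm
    have hNo : IsOpen (connectedComponentIn {y}ᶜ q) := isOpen_compl_singleton.connectedComponentIn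
    have hV := hqN _ isPreconnected_connectedComponentIn hNo (mem_connectedComponentIn hqy)
    set V := Bᶜ ∪ connectedComponentIn {y}ᶜ q
    have hVo : IsOpen V := hBn.isClosed.isOpen_compl.union hNo
    have hyV : y ∈ Vᶜ := by
      rintro (h | h)
      · exact h hy
      · exact connectedComponentIn_subset {y}ᶜ q h rfl
    have hsub : connectedComponentIn Vᶜ y ⊆ B := fun z hz => by
      by_contra hzB
      exact connectedComponentIn_subset Vᶜ y hz (Or.inl hzB)
    have hle := hB.le_of_le (y := connectedComponentIn Vᶜ y)
      ⟨hVo.isClosed_compl.connectedComponentIn y, isConnected_connectedComponentIn_iff.2 hyV,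
        isPreconnected_compl_connectedComponentIn_compl hV y⟩ hsub
    exact connectedComponentIn_subset Vᶜ y (hle hq) (Or.inr (mem_connectedComponentIn hqy))
  exact ⟨q, hBA hq, hBq ▸ hBn.isPreconnected_compl⟩

/-- Every component of the complement of a point contains a noncut point. -/
theorem exists_mem_connectedComponentIn_isPreconnected_compl_singleton {p c : X} (hc : c ≠ p) :
    ∃ a ∈ connectedComponentIn {p}ᶜ c, IsPreconnected ({a}ᶜ : Set X) := by
  have hcc : c ∈ connectedComponentIn {p}ᶜ c := mem_connectedComponentIn hc
  have hpc : p ∈ ({c}ᶜ : Set X) := hc.symm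
  have hNo : IsOpen (connectedComponentIn {c}ᶜ p) := isOpen_compl_singleton.connectedComponentIn
  have hV : IsPreconnected ((connectedComponentIn {p}ᶜ c)ᶜ ∪ connectedComponentIn {c}ᶜ p) :=
    (isPreconnected_compl_connectedComponentIn_compl isPreconnected_singleton c).union p
      (fun h => connectedComponentIn_subset {p}ᶜ c h rfl) (mem_connectedComponentIn hpc)
      isPreconnected_connectedComponentIn
  set V := (connectedComponentIn {p}ᶜ c)ᶜ ∪ connectedComponentIn {c}ᶜ p with hVdef
  have hVc : IsClosed Vᶜ := by
    have : Vᶜ = closure (connectedComponentIn {p}ᶜ c) ∩ (connectedComponentIn {c}ᶜ p)ᶜ := by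
      rw [closure_connectedComponentIn_compl_singleton hc, hVdef, compl_union, compl_compl,
        insert_inter_of_notMem]
      exact not_not.2 (mem_connectedComponentIn hpc)
    rw [this]
    exact isClosed_closure.inter hNo.isClosed_compl
  have hcV : c ∈ Vᶜ := by
    rintro (h | h)
    · exact h hcc
    · exact connectedComponentIn_subset {c}ᶜ p h rfl
  obtain ⟨a, ha, ha'⟩ := IsNonseparatingContinuum.exists_mem_isPreconnected_compl_singleton
    (A := connectedComponentIn Vᶜ c) ⟨hVc.connectedComponentIn c,
      isConnected_connectedComponentIn_iff.2 hcV,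
      isPreconnected_compl_connectedComponentIn_compl hV c⟩
  refine ⟨a, ?_, ha'⟩
  by_contra h
  exact connectedComponentIn_subset Vᶜ c ha (Or.inl h)

/-- Assume nonseparating continua form a compact family. If `z` and `c` lie in different components
of `{p}ᶜ`, then all points near `p` outside the component of `c` separate `z` from `p`. -/
theorem eventually_separates_singleton
    (hX : ∀ F : Set X, IsClosed F → IsClosed (⋃₀ {A | IsNonseparatingContinuum A ∧ A ⊆ F}))
    {p c z : X} (hc : c ≠ p) (hz : z ≠ p) (hzc : z ∉ connectedComponentIn {p}ᶜ c) :
    ∀ᶠ x in 𝓝 p, x ∉ connectedComponentIn {p}ᶜ c → x ≠ p → Separates {x} z p := by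
  set C := connectedComponentIn {p}ᶜ c
  have hCo : IsOpen C := isOpen_compl_singleton.connectedComponentIn
  have hcC : c ∈ C := mem_connectedComponentIn hc
  obtain ⟨F, hF, hFc, hFp⟩ := exists_mem_nhds_isClosed_subset
    (isOpen_compl_singleton.mem_nhds (show z ∈ ({p}ᶜ : Set X) from hz))
  set N := connectedComponentIn (interior F) z
  have hNo : IsOpen N := isOpen_interior.connectedComponentIn
  have hzN : z ∈ N := mem_connectedComponentIn (mem_interior_iff_mem_nhds.2 hF)
  have hNF : N ⊆ F := (connectedComponentIn_subset _ _).trans interior_subset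
  have hclN : p ∉ F := fun h => hFp h rfl
  have hG := hX _ (hCo.union hNo).isClosed_compl
  have hpG : p ∉ ⋃₀ {A | IsNonseparatingContinuum A ∧ A ⊆ (C ∪ N)ᶜ} := by
    rintro ⟨A, ⟨hA, hAs⟩, hpA⟩
    refine hzc (hA.isPreconnected_compl.subset_connectedComponentIn
      (fun h => hAs h (Or.inl hcC)) ?_ fun h => hAs h (Or.inr hzN))
    exact compl_subset_compl.2 (singleton_subset_iff.2 hpA)
  filter_upwards [hFc.isOpen_compl.mem_nhds hclN, hG.isOpen_compl.mem_nhds hpG]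
    with x hxF hxG hxC hxp
  rw [separates_singleton_iff]
  intro T hT hzT hpT
  by_contra hxT
  have hUo : IsOpen (connectedComponentIn {x}ᶜ p) := isOpen_compl_singleton.connectedComponentIn
  have hTU : T ∪ N ⊆ connectedComponentIn {x}ᶜ p := by
    refine (hT.union z hzT hzN isPreconnected_connectedComponentIn).subset_connectedComponentIn
      (Or.inl hpT) ?_
    rintro y (hy | hy) rfl
    · exact hxT hy
    · exact hxF (hNF hy)
  have hCU : insert p C ⊆ connectedComponentIn {x}ᶜ p := by
    have hpre : IsPreconnected (insert p C) := by
      rw [← closure_connectedComponentIn_compl_singleton hc]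
      exact isPreconnected_connectedComponentIn.closure
    refine hpre.subset_connectedComponentIn (mem_insert _ _) ?_
    rintro y (hy | hy) rfl
    · exact hxp hy
    · exact hxC hy
  refine hxG ⟨(connectedComponentIn {x}ᶜ p)ᶜ, ⟨⟨hUo.isClosed_compl, ⟨⟨x, ?_⟩, ?_⟩, ?_⟩, ?_⟩, ?_⟩
  · exact fun h => connectedComponentIn_subset {x}ᶜ p h rfl
  · exact isPreconnected_compl_connectedComponentIn_compl isPreconnected_singleton p
  · rw [compl_compl]; exact isPreconnected_connectedComponentIn
  · refine compl_subset_compl.2 (union_subset ?_ ?_)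
    · exact (subset_insert _ _).trans hCU
    · exact subset_union_right.trans hTU
  · exact fun h => connectedComponentIn_subset {x}ᶜ p h rfl

end Separation

section CutPoint

/-- If nonseparating continua form a compact family, a locally connected continuum with a cut
point is an arc. -/
theorem exists_homeomorph_unitInterval_of_cutPoint {X : Type*} [MetricSpace X] [CompactSpace X]
    [ConnectedSpace X] [LocallyConnectedSpace X]
    (hX : ∀ F : Set X, IsClosed F → IsClosed (⋃₀ {A | IsNonseparatingContinuum A ∧ A ⊆ F}))
    {p : X} (hp : ¬ IsPreconnected ({p}ᶜ : Set X)) : Nonempty (X ≃ₜ unitInterval) := by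
  obtain ⟨c₁, c₂, hc₁, hc₂, hc⟩ : ∃ c₁ c₂, c₁ ≠ p ∧ c₂ ≠ p ∧ c₂ ∉ connectedComponentIn {p}ᶜ c₁ := by
    by_contra! h
    exact hp (isPreconnected_of_forall_pair fun x hx y hy =>
      ⟨_, connectedComponentIn_subset _ _, mem_connectedComponentIn hx, h x y hx hy,
        isPreconnected_connectedComponentIn⟩)
  obtain ⟨a, hac, ha⟩ := exists_mem_connectedComponentIn_isPreconnected_compl_singleton hc₁
  obtain ⟨b, hbc, hb⟩ := exists_mem_connectedComponentIn_isPreconnected_compl_singleton hc₂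
  have hap : a ≠ p := connectedComponentIn_subset {p}ᶜ c₁ hac
  have hbp : b ≠ p := connectedComponentIn_subset {p}ᶜ c₂ hbc
  have hne : connectedComponentIn {p}ᶜ a ≠ connectedComponentIn {p}ᶜ b := by
    rw [← connectedComponentIn_eq hac, ← connectedComponentIn_eq hbc]
    exact fun h => hc (h ▸ mem_connectedComponentIn hc₂)
  have hbOa : b ∉ connectedComponentIn {p}ᶜ a := fun h => hne (connectedComponentIn_eq h)
  have hab : a ≠ b := fun h => hne (h ▸ rfl)
  have hsepp : Separates {p} a b := by
    rw [separates_singleton_iff]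
    intro T hT haT hbT
    by_contra hpT
    exact hbOa (hT.subset_connectedComponentIn (F := {p}ᶜ) haT
      (fun y hy hyp => hpT (mem_singleton_iff.1 hyp ▸ hy)) hbT)
  have hSo : IsOpen {x | x ≠ a ∧ x ≠ b ∧ Separates {x} a b} := by
    rw [isOpen_iff_mem_nhds]
    rintro q ⟨hqa, hqb, hq⟩
    have hq' := hq
    rw [separates_singleton_iff] at hq'
    have hbCa := hq.notMem_connectedComponentIn
    have haCb : a ∉ connectedComponentIn {q}ᶜ b := fun h =>
      hbCa (connectedComponentIn_eq h ▸ mem_connectedComponentIn hqb.symm)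
    filter_upwards [eventually_separates_singleton hX hqb.symm hqa.symm haCb,
      eventually_separates_singleton hX hqa.symm hqb.symm hbCa,
      isOpen_compl_singleton.mem_nhds (show q ∈ ({a}ᶜ : Set X) from hqa),
      isOpen_compl_singleton.mem_nhds (show q ∈ ({b}ᶜ : Set X) from hqb)] with x h1 h2 hxa hxb
    refine ⟨hxa, hxb, ?_⟩
    by_cases hxq : x = q
    · exact hxq ▸ hq
    rw [separates_singleton_iff] at h1 h2 ⊢
    intro T hT haT hbT
    have hqT := hq' T hT haT hbT
    by_cases hxC : x ∈ connectedComponentIn {q}ᶜ b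
    · refine h2 (fun hxC' => hbCa ?_) hxq T hT hbT hqT
      rw [connectedComponentIn_eq hxC', ← connectedComponentIn_eq hxC]
      exact mem_connectedComponentIn hqb.symm
    · exact h1 hxC hxq T hT haT hqT
  set S := {x | x ≠ a ∧ x ≠ b ∧ Separates {x} a b}
  set R := {x | x ≠ a ∧ x ≠ b ∧ ¬ Separates {x} a b}
  have hpS : p ∈ S := ⟨hap.symm, hbp.symm, hsepp⟩
  have hRo : IsOpen R := by
    rw [isOpen_iff_mem_nhds]
    rintro x ⟨hxa, hxb, hx⟩
    rw [separates_singleton_iff] at hx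
    push Not at hx
    obtain ⟨T, hT, haT, hbT, hxT⟩ := hx
    have hbC := hT.subset_connectedComponentIn (F := {x}ᶜ) haT
      (fun y hy hyp => hxT (mem_singleton_iff.1 hyp ▸ hy)) hbT
    have haC := mem_connectedComponentIn (show a ∈ ({x}ᶜ : Set X) from hxa.symm)
    obtain ⟨M, hM, hMc, habM, hMs⟩ := isPreconnected_connectedComponentIn.exists_isConnected_between
      isOpen_compl_singleton.connectedComponentIn ⟨a, haC⟩ (toFinite {a, b}).isCompact
      (insert_subset haC (singleton_subset_iff.2 hbC))
    have hxM : x ∉ M := fun h => connectedComponentIn_subset {x}ᶜ a (hMs h) rfl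
    filter_upwards [hMc.isOpen_compl.mem_nhds hxM,
      isOpen_compl_singleton.mem_nhds (show x ∈ ({a}ᶜ : Set X) from hxa),
      isOpen_compl_singleton.mem_nhds (show x ∈ ({b}ᶜ : Set X) from hxb)] with y h1 h2 h3
    refine ⟨h2, h3, fun h => h1 ?_⟩
    exact separates_singleton_iff.1 h M hM.isPreconnected (habM (Or.inl rfl)) (habM (Or.inr rfl))
  have hclR : closure R ⊆ Sᶜ := closure_minimal (fun x hx hxS => hx.2.2 hxS.2.2) hSo.isClosed_compl
  have hSR : ∀ x, x ≠ a → x ≠ b → x ∉ S → x ∈ R :=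
    fun x h1 h2 h3 => ⟨h1, h2, fun h => h3 ⟨h1, h2, h⟩⟩
  have hOa : IsOpen (connectedComponentIn {p}ᶜ a) := isOpen_compl_singleton.connectedComponentIn
  have hclOa := closure_connectedComponentIn_compl_singleton hap
  have haOa : a ∈ connectedComponentIn {p}ᶜ a := mem_connectedComponentIn hap
  have hpOa : p ∉ connectedComponentIn {p}ᶜ a := fun h => connectedComponentIn_subset {p}ᶜ a h rfl
  set O := connectedComponentIn {p}ᶜ a
  have hRO : ∀ x ∈ R, x ∉ O := by
    intro x hxR hxO
    refine hpOa (compl_singleton_subset_of_isOpen ha (hRo.inter hOa) (fun y hy => ?_)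
      ⟨x, ⟨hxR, hxO⟩, hxR.1⟩ (show p ∈ ({a}ᶜ : Set X) from hap.symm)).2
    have hyS := hclR (closure_mono inter_subset_left hy)
    have hyO : y ∈ O := (hclOa ▸ closure_mono inter_subset_right hy : y ∈ insert p O).resolve_left
      fun h => hyS (h ▸ hpS)
    by_cases hya : y = a
    · exact Or.inr hya
    · exact Or.inl ⟨hSR y hya (fun h => hbOa (h ▸ hyO)) hyS, hyO⟩
  have hRO' : ∀ x ∈ R, x ∈ O := by
    intro x hxR
    by_contra hxO
    have hxcl : x ∉ closure O := by
      rw [hclOa]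
      rintro (h | h)
      · exact hxR.2.2 (h ▸ hsepp)
      · exact hxO h
    refine (compl_singleton_subset_of_isOpen hb (hRo.inter isClosed_closure.isOpen_compl)
      (fun y hy => ?_) ⟨x, ⟨hxR, hxcl⟩, hxR.2.1⟩ (show p ∈ ({b}ᶜ : Set X) from hbp.symm)).2 ?_
    · have hyS := hclR (closure_mono inter_subset_left hy)
      have hyO : y ∉ O := closure_minimal (compl_subset_compl.2 subset_closure) hOa.isClosed_compl
        (closure_mono inter_subset_right hy)
      by_cases hyb : y = b
      · exact Or.inr hyb
      · refine Or.inl ⟨hSR y (fun h => hyO (h ▸ haOa)) hyb hyS, ?_⟩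
        rw [hclOa]
        rintro (h | h)
        · exact hyS (h ▸ hpS)
        · exact hyO h
    · rw [hclOa]
      exact mem_insert _ _
  have hsep : ∀ x, x ≠ a → x ≠ b → Separates {x} a b := by
    intro x hxa hxb
    by_contra h
    exact hRO x ⟨hxa, hxb, h⟩ (hRO' x ⟨hxa, hxb, h⟩)
  obtain ⟨e, -⟩ := exists_homeomorph_unitInterval_of_separates hab fun x hxa hxb => by
    refine ⟨connectedComponentIn {x}ᶜ a, (closure (connectedComponentIn {x}ᶜ a))ᶜ,
      isOpen_compl_singleton.connectedComponentIn, isClosed_closure.isOpen_compl,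
      mem_connectedComponentIn hxa.symm, ?_, ?_, ?_⟩
    · rw [closure_connectedComponentIn_compl_singleton hxa.symm]
      rintro (h | h)
      · exact hxb h.symm
      · exact (hsep x hxa hxb).notMem_connectedComponentIn h
    · exact disjoint_compl_right_iff_subset.2 subset_closure
    · rw [closure_connectedComponentIn_compl_singleton hxa.symm]
      ext y
      have := @connectedComponentIn_subset X _ {x}ᶜ a y
      simp only [mem_union, mem_compl_iff, mem_insert_iff, mem_singleton_iff] at this ⊢
      tauto
  exact ⟨e⟩

end CutPoint

section CutPair

/-- Boundary bumping inside a continuum `A`. -/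
theorem IsConnected.exists_isConnected_between_ssubset {X : Type*} [TopologicalSpace X]
    [CompactSpace X] [T2Space X] {K A : Set X} (hA : IsConnected A) (hAc : IsClosed A)
    (hK : IsConnected K) (hKc : IsClosed K) (hKA : K ⊂ A) :
    ∃ L, IsConnected L ∧ IsClosed L ∧ K ⊂ L ∧ L ⊂ A := by
  have : CompactSpace A := isCompact_iff_compactSpace.1 hAc.isCompact
  have : PreconnectedSpace A := isPreconnected_iff_preconnectedSpace.1 hA.isPreconnected
  have himg : ((↑) : A → X) '' ((↑) ⁻¹' K) = K := by
    rw [Subtype.image_preimage_coe, inter_eq_right.2 hKA.subset]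
  have hK' : IsConnected (((↑) : A → X) ⁻¹' K) := by
    refine ⟨?_, IsInducing.subtypeVal.isPreconnected_image.1 (by rw [himg]; exact hK.2)⟩
    obtain ⟨x, hx⟩ := hK.nonempty
    exact ⟨⟨x, hKA.subset hx⟩, hx⟩
  obtain ⟨L, hL, hLc, hKL, hLu⟩ := exists_isConnected_ssubset hK'
    (hKc.preimage continuous_subtype_val) (fun h => hKA.not_subset fun x hx =>
      (h ▸ mem_univ _ : (⟨x, hx⟩ : A) ∈ ((↑) : A → X) ⁻¹' K))
  refine ⟨(↑) '' L, hL.image _ continuous_subtype_val.continuousOn,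
    hAc.isClosedMap_subtype_val _ hLc, ?_, ?_⟩
  · rw [← himg]
    exact Subtype.val_injective.image_strictMono hKL
  · refine (Subtype.coe_image_subset A L).ssubset_of_ne fun h => hLu ?_
    refine eq_univ_of_forall fun x => ?_
    obtain ⟨y, hy, hyx⟩ := (Set.ext_iff.1 h x).2 x.2
    exact Subtype.ext hyx ▸ hy

variable {X : Type*} [TopologicalSpace X] [T2Space X] [CompactSpace X] [LocallyConnectedSpace X]

/-- Closed sets separating two points are stable under nested intersections. -/
theorem separates_sInter_of_isChain {c : Set (Set X)} {a b : X} (hc : IsChain (· ⊆ ·) c)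
    (hne : c.Nonempty) (hcl : ∀ A ∈ c, IsClosed A) (hsep : ∀ A ∈ c, Separates A a b) :
    Separates (⋂₀ c) a b := by
  have hS : IsClosed (⋂₀ c) := isClosed_sInter hcl
  intro T hT haT hbT
  by_contra hd
  rw [not_nonempty_iff_eq_empty, ← disjoint_iff_inter_eq_empty, ← subset_compl_iff_disjoint_right]
    at hd
  have haC := mem_connectedComponentIn (hd haT)
  obtain ⟨M, hM, hMc, habM, hMs⟩ := isPreconnected_connectedComponentIn.exists_isConnected_between
    (U := connectedComponentIn (⋂₀ c)ᶜ a) hS.isOpen_compl.connectedComponentIn ⟨a, haC⟩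
    (toFinite {a, b}).isCompact
    (insert_subset haC (singleton_subset_iff.2 (hT.subset_connectedComponentIn haT hd hbT)))
  have hdir : Directed (· ⊇ ·) fun A : c => M ∩ (A : Set X) := by
    rintro ⟨A, hA⟩ ⟨B, hB⟩
    rcases hc.total hA hB with h | h
    · exact ⟨⟨A, hA⟩, subset_rfl, inter_subset_inter_right _ h⟩
    · exact ⟨⟨B, hB⟩, inter_subset_inter_right _ h, subset_rfl⟩
  have : Nonempty c := hne.to_subtype
  obtain ⟨x, hx⟩ := IsCompact.nonempty_iInter_of_directed_nonempty_isCompact_isClosed _ hdir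
    (fun A => hsep A A.2 M hM.isPreconnected (habM (Or.inl rfl)) (habM (Or.inr rfl)))
    (fun A => (hMc.inter (hcl A A.2)).isCompact) (fun A => hMc.inter (hcl A A.2))
  rw [mem_iInter] at hx
  obtain ⟨A, hA⟩ := hne
  exact connectedComponentIn_subset _ _ (hMs (hx ⟨A, hA⟩).1) fun B hB => (hx ⟨B, hB⟩).2

variable [ConnectedSpace X]

/-- If nonseparating continua form a compact family and no point of `X` is a cut point, then any two
points of `X` form a cut pair. -/
theorem not_isPreconnected_compl_pair
    (hX : ∀ (F : Set X) (c : Set (Set X)), IsClosed F → IsChain (· ⊆ ·) c → c.Nonempty →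
      (∀ K ∈ c, ∃ B, IsNonseparatingContinuum B ∧ K ⊆ B ∧ B ⊆ F) →
      ∃ B, IsNonseparatingContinuum B ∧ ⋃₀ c ⊆ B ∧ B ⊆ F)
    (hcut : ∀ x : X, IsPreconnected ({x}ᶜ : Set X)) {a b : X} (hab : a ≠ b) :
    ¬ IsPreconnected ({a, b}ᶜ : Set X) := by
  intro hpre
  obtain ⟨U, V, hU, hV, haU, hbV, hUV⟩ := t2_separation hab
  obtain ⟨x₁, hx₁⟩ : ((U ∪ V)ᶜ : Set X).Nonempty := by
    rw [nonempty_compl]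
    intro h
    rcases isPreconnected_univ.subset_or_subset hU hV hUV h.ge with h' | h'
    · exact Set.disjoint_left.1 hUV (h' (mem_univ b)) hbV
    · exact Set.disjoint_left.1 hUV haU (h' (mem_univ a))
  have hCab : (U ∪ V)ᶜ ⊆ ({a, b}ᶜ : Set X) := by
    refine compl_subset_compl.2 (insert_subset (Or.inl haU) (singleton_subset_iff.2 (Or.inr hbV)))
  obtain ⟨M, hM, hMc, hCM, hMab⟩ := hpre.exists_isConnected_between
    (toFinite {a, b}).isClosed.isOpen_compl ⟨x₁, hCab hx₁⟩
    (hU.union hV).isClosed_compl.isCompact hCab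
  have haM : a ∉ M := fun h => hMab h (Or.inl rfl)
  have hbM : b ∉ M := fun h => hMab h (Or.inr rfl)
  have hMsep : Separates M a b := by
    intro T hT haT hbT
    by_contra hd
    rw [not_nonempty_iff_eq_empty, ← disjoint_iff_inter_eq_empty] at hd
    rcases hT.subset_or_subset hU hV hUV fun x hx => by
      by_contra h
      exact Set.disjoint_left.1 hd hx (hCM h) with h' | h'
    · exact Set.disjoint_left.1 hUV (h' hbT) hbV
    · exact Set.disjoint_left.1 hUV haU (h' haT)
  obtain ⟨A, hAM, hA⟩ := zorn_superset_nonempty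
    {A : Set X | IsClosed A ∧ IsConnected A ∧ Separates A a b} (by
      intro c hc hch hne
      exact ⟨⋂₀ c, ⟨isClosed_sInter fun B hB => (hc hB).1,
        isConnected_sInter_of_isChain hch hne (fun B hB => (hc hB).1) fun B hB => (hc hB).2.1,
        separates_sInter_of_isChain hch hne (fun B hB => (hc hB).1) fun B hB => (hc hB).2.2⟩,
        fun B hB => sInter_subset_of_mem hB⟩) M ⟨hMc, hM, hMsep⟩
  obtain ⟨hAc, hAconn, hAsep⟩ := hA.prop
  set Na := connectedComponentIn Mᶜ a
  set Nb := connectedComponentIn Mᶜ b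
  have hF : IsClosed (Na ∪ Nb)ᶜ := by
    refine (IsOpen.union ?_ ?_).isClosed_compl <;>
    exact hMc.isOpen_compl.connectedComponentIn
  have hfill : ∀ K, IsClosed K → IsConnected K → K ⊆ A → ¬ Separates K a b →
      ∃ B, IsNonseparatingContinuum B ∧ K ⊆ B ∧ B ⊆ (Na ∪ Nb)ᶜ := by
    intro K hKc hK hKA hKsep
    simp only [Separates, not_forall, not_nonempty_iff_eq_empty] at hKsep
    obtain ⟨T, hT, haT, hbT, hTK⟩ := hKsep
    rw [← disjoint_iff_inter_eq_empty, ← subset_compl_iff_disjoint_right] at hTK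
    have hbC : b ∈ connectedComponentIn Kᶜ a := hT.subset_connectedComponentIn haT hTK hbT
    have hMK : Mᶜ ⊆ Kᶜ := compl_subset_compl.2 (hKA.trans hAM)
    have hKB : K ⊆ (connectedComponentIn Kᶜ a)ᶜ :=
      subset_compl_comm.1 (connectedComponentIn_subset _ _)
    refine ⟨(connectedComponentIn Kᶜ a)ᶜ,
      ⟨hKc.isOpen_compl.connectedComponentIn.isClosed_compl, ⟨hK.nonempty.mono hKB, ?_⟩, ?_⟩,
      hKB, compl_subset_compl.2 (union_subset ?_ ?_)⟩
    · exact isPreconnected_compl_connectedComponentIn_compl hK.isPreconnected a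
    · rw [compl_compl]; exact isPreconnected_connectedComponentIn
    · exact connectedComponentIn_mono _ hMK
    · rw [connectedComponentIn_eq hbC]
      exact connectedComponentIn_mono _ hMK
  obtain ⟨x₀, hx₀⟩ := hAconn.nonempty
  obtain ⟨K, -, hK⟩ := zorn_subset_nonempty
    {K : Set X | IsClosed K ∧ IsConnected K ∧ K ⊆ A ∧ ¬ Separates K a b} (by
      intro c hc hch hne
      obtain ⟨B, hB, hcB, hBF⟩ := hX _ c hF hch hne fun K hK =>
        hfill K (hc hK).1 (hc hK).2.1 (hc hK).2.2.1 (hc hK).2.2.2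
      refine ⟨closure (⋃₀ c), ⟨isClosed_closure, ⟨?_, IsPreconnected.closure ?_⟩,
        closure_minimal (sUnion_subset fun K hK => (hc hK).2.2.1) hAc, fun hsep => ?_⟩,
        fun K hK => (subset_sUnion_of_mem hK).trans subset_closure⟩
      · obtain ⟨K, hK⟩ := hne
        exact (hc hK).2.1.nonempty.mono ((subset_sUnion_of_mem hK).trans subset_closure)
      · exact IsPreconnected.sUnion_directed hch.directedOn fun K hK => (hc hK).2.1.isPreconnected
      · obtain ⟨x, hxB, hx⟩ := hsep Bᶜ hB.isPreconnected_compl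
          (fun h => hBF h (Or.inl (mem_connectedComponentIn haM)))
          (fun h => hBF h (Or.inr (mem_connectedComponentIn hbM)))
        exact hxB (closure_minimal hcB hB.isClosed hx)) {x₀} (by
      refine ⟨isClosed_singleton, isConnected_singleton, singleton_subset_iff.2 hx₀, fun h => ?_⟩
      obtain ⟨x, hx, hx'⟩ := h {x₀}ᶜ (hcut x₀) (fun h => haM (h ▸ hAM hx₀))
        (fun h => hbM (h ▸ hAM hx₀))
      exact hx hx')
  obtain ⟨hKc, hKconn, hKA, hKsep⟩ := hK.prop
  obtain ⟨L, hL, hLc, hKL, hLA⟩ := hAconn.exists_isConnected_between_ssubset hAc hKconn hKc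
    (hKA.ssubset_of_ne fun h => hKsep (h ▸ hAsep))
  have hLsep : ¬ Separates L a b := fun h =>
    hLA.not_subset (hA.le_of_le (y := L) ⟨hLc, hL, h⟩ hLA.subset)
  exact hKL.not_subset (hK.le_of_ge (y := L) ⟨hLc, hL, hLA.subset, hLsep⟩ hKL.subset)

end CutPair

section CircleCase

theorem exists_isOpen_of_not_isPreconnected {X : Type*} [TopologicalSpace X] {s : Set X}
    (hs : IsOpen s) (h : ¬ IsPreconnected s) : ∃ P Q : Set X, IsOpen P ∧ IsOpen Q ∧ P.Nonempty ∧
      Q.Nonempty ∧ Disjoint P Q ∧ P ∪ Q = s := by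
  simp only [IsPreconnected, not_forall, not_nonempty_iff_eq_empty] at h
  obtain ⟨u, v, hu, hv, hsuv, hsu, hsv, hd⟩ := h
  refine ⟨s ∩ u, s ∩ v, hs.inter hu, hs.inter hv, hsu, hsv, ?_, ?_⟩
  · rw [disjoint_iff_inter_eq_empty, ← inter_inter_distrib_left, hd]
  · rw [← inter_union_distrib_left, inter_eq_left.2 hsuv]

/-- Two cut pairs `{a, b}` and `{x, y}` of a space, where `a` and `b` lie on the same side of
`{x, y}` and `x` is a noncut point: the other side of `{x, y}` is disjoint from the side of
`{a, b}` not containing `y`. -/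
theorem disjoint_of_cutPairs {X : Type*} [TopologicalSpace X] {a b x y : X} {P Q G H : Set X}
    (hx : IsPreconnected ({x}ᶜ : Set X)) (hP : IsOpen P) (hQ : IsOpen Q) (hG : IsOpen G)
    (hH : IsOpen H) (hPQ : Disjoint P Q) (hPQu : P ∪ Q = {a, b}ᶜ) (hGH : Disjoint G H)
    (hGHu : G ∪ H = {x, y}ᶜ) (ha : a ∈ G) (hb : b ∈ G) (hy : y ∈ Q) : Disjoint H P := by
  have h1 := fun z => Set.ext_iff.1 hPQu z
  have h2 := fun z => Set.ext_iff.1 hGHu z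
  simp only [mem_union, mem_compl_iff, mem_insert_iff, mem_singleton_iff] at h1 h2
  rw [Set.disjoint_left]
  intro z hzH hzP
  have hxH : x ∉ H := fun h => (h2 x).1 (Or.inr h) (Or.inl rfl)
  have haP : a ∉ P := fun h => (h1 a).1 (Or.inl h) (Or.inl rfl)
  refine haP (compl_singleton_subset_of_isOpen hx (hH.inter hP) (fun w hw => ?_)
    ⟨z, ⟨hzH, hzP⟩, fun h => hxH (mem_singleton_iff.1 h ▸ hzH)⟩
    (show a ∈ ({x}ᶜ : Set X) from fun h => (h2 a).1 (Or.inl ha) (Or.inl h))).2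
  have hwG : w ∉ G := closure_minimal (subset_compl_iff_disjoint_left.2 hGH) hG.isClosed_compl
    (closure_mono inter_subset_left hw)
  have hwQ : w ∉ Q := closure_minimal (subset_compl_iff_disjoint_right.2 hPQ) hQ.isClosed_compl
    (closure_mono inter_subset_right hw)
  by_cases hwx : w = x
  · exact Or.inr hwx
  refine Or.inl ⟨((h2 w).2 ?_).resolve_left hwG, ((h1 w).2 ?_).resolve_right hwQ⟩
  · rintro (rfl | rfl)
    · exact hwx rfl
    · exact hwQ hy
  · rintro (rfl | rfl)
    · exact hwG ha
    · exact hwG hb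

/-- In a connected space without cut points, adding a cut pair to a side of it gives a connected
set. -/
theorem isPreconnected_compl_of_cutPair {X : Type*} [TopologicalSpace X] {a b : X} {P Q : Set X}
    (hcut : ∀ x : X, IsPreconnected ({x}ᶜ : Set X)) (hab : a ≠ b) (hP : IsOpen P) (hQ : IsOpen Q)
    (hne : P.Nonempty) (hPQ : Disjoint P Q) (hPQu : P ∪ Q = {a, b}ᶜ) : IsPreconnected Qᶜ := by
  have h1 := fun z => Set.ext_iff.1 hPQu z
  simp only [mem_union, mem_compl_iff, mem_insert_iff, mem_singleton_iff] at h1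
  have haP : a ∉ P := fun h => (h1 a).1 (Or.inl h) (Or.inl rfl)
  have hbP : b ∉ P := fun h => (h1 b).1 (Or.inl h) (Or.inr rfl)
  have haQ : a ∈ Qᶜ := fun h => (h1 a).1 (Or.inr h) (Or.inl rfl)
  have hbQ : b ∈ Qᶜ := fun h => (h1 b).1 (Or.inr h) (Or.inr rfl)
  have hPQ' : P ⊆ Qᶜ := subset_compl_iff_disjoint_right.2 hPQ
  have key : ∀ u v : Set X, IsClosed u → IsClosed v → Qᶜ ⊆ u ∪ v → (∀ z ∈ Qᶜ, z ∈ u → z ∉ v) →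
      (a ∉ v ∨ b ∉ v) → P ⊆ u := by
    intro u v hu hv hcov hd hv'
    obtain ⟨x, x', hx'x, hxP, hx'P, hx⟩ : ∃ x x', x' ≠ x ∧ x ∉ P ∧ x' ∉ P ∧
        ∀ y, y = a ∨ y = b → y ∈ v → y = x := by
      rcases hv' with h | h
      · exact ⟨b, a, hab, hbP, haP, fun y hy hyv => hy.resolve_left fun h' => h (h' ▸ hyv)⟩
      · exact ⟨a, b, hab.symm, haP, hbP, fun y hy hyv => hy.resolve_right fun h' => h (h' ▸ hyv)⟩
    intro z hzP
    by_contra hzu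
    have hcl : closure (P ∩ uᶜ) ⊆ Qᶜ ∩ v :=
      closure_minimal (fun y hy => ⟨hPQ' hy.1, (hcov (hPQ' hy.1)).resolve_left hy.2⟩)
        (hQ.isClosed_compl.inter hv)
    refine hx'P (compl_singleton_subset_of_isOpen (hcut x) (hP.inter hu.isOpen_compl)
      (fun y hy => ?_) ⟨z, ⟨hzP, hzu⟩, fun h => hxP (mem_singleton_iff.1 h ▸ hzP)⟩ hx'x).1
    obtain ⟨hyQ, hyv⟩ := hcl hy
    by_cases hyP : y ∈ P
    · exact Or.inl ⟨hyP, fun h => hd y hyQ h hyv⟩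
    · right
      refine hx y ?_ hyv
      by_contra h
      exact ((h1 y).2 h).elim hyP hyQ
  have hQsub : ∀ u : Set X, P ⊆ u → a ∈ u → b ∈ u → Qᶜ ⊆ u := by
    intro u hPu hau hbu y hyQ
    by_cases hy : y = a ∨ y = b
    · rcases hy with rfl | rfl
      · exact hau
      · exact hbu
    · exact hPu (((h1 y).2 hy).resolve_right hyQ)
  rw [isPreconnected_iff_subset_of_disjoint_closed]
  intro u v hu hv hcov hd
  have hd' : ∀ z ∈ Qᶜ, z ∈ u → z ∉ v := fun z hz hzu hzv => (Set.ext_iff.1 hd z).1 ⟨hz, hzu, hzv⟩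
  have hd'' : ∀ z ∈ Qᶜ, z ∈ v → z ∉ u := fun z hz hzv hzu => hd' z hz hzu hzv
  have hcov' : Qᶜ ⊆ v ∪ u := by rwa [union_comm]
  have hnot : (a ∉ v ∨ b ∉ v) → (a ∉ u ∨ b ∉ u) → False := fun h h' => by
    obtain ⟨z, hz⟩ := hne
    exact hd' z (hPQ' hz) (key u v hu hv hcov hd' h hz) (key v u hv hu hcov' hd'' h' hz)
  rcases hcov haQ with ha | ha <;> rcases hcov hbQ with hb | hb
  · exact Or.inl (hQsub u (key u v hu hv hcov hd' (Or.inl (hd' a haQ ha))) ha hb)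
  · exact (hnot (Or.inl (hd' a haQ ha)) (Or.inr (hd'' b hbQ hb))).elim
  · exact (hnot (Or.inr (hd' b hbQ hb)) (Or.inl (hd'' a haQ ha))).elim
  · exact Or.inr (hQsub v (key v u hv hu hcov' hd'' (Or.inl (hd'' a haQ ha))) ha hb)

/-- If any two points of a metric continuum without cut points form a cut pair, then each side of a
cut pair is an arc. -/
theorem exists_homeomorph_unitInterval_of_cutPair {X : Type*} [MetricSpace X] [CompactSpace X]
    (hcut : ∀ x : X, IsPreconnected ({x}ᶜ : Set X))
    (hpair : ∀ x y : X, x ≠ y → ¬ IsPreconnected ({x, y}ᶜ : Set X))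
    {a b : X} {P Q : Set X} (hab : a ≠ b) (hP : IsOpen P) (hQ : IsOpen Q)
    (hPne : P.Nonempty) (hQne : Q.Nonempty) (hPQ : Disjoint P Q) (hPQu : P ∪ Q = {a, b}ᶜ) :
    ∃ e : ↥Qᶜ ≃ₜ unitInterval, (∀ h : a ∈ Qᶜ, e ⟨a, h⟩ = 0) ∧ ∀ h : b ∈ Qᶜ, e ⟨b, h⟩ = 1 := by
  have h1 := fun z => Set.ext_iff.1 hPQu z
  simp only [mem_union, mem_compl_iff, mem_insert_iff, mem_singleton_iff] at h1
  have haQ : a ∈ Qᶜ := fun h => (h1 a).1 (Or.inr h) (Or.inl rfl)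
  have hbQ : b ∈ Qᶜ := fun h => (h1 b).1 (Or.inr h) (Or.inr rfl)
  have : CompactSpace ↥Qᶜ := isCompact_iff_compactSpace.1 hQ.isClosed_compl.isCompact
  have : PreconnectedSpace ↥Qᶜ := isPreconnected_iff_preconnectedSpace.1
    (isPreconnected_compl_of_cutPair hcut hab hP hQ hPne hPQ hPQu)
  obtain ⟨e, hea, heb⟩ := exists_homeomorph_unitInterval_of_separates (Y := ↥Qᶜ)
    (a := ⟨a, haQ⟩) (b := ⟨b, hbQ⟩) (fun h => hab (congrArg Subtype.val h)) (by
      rintro ⟨x, hxQ⟩ hxa hxb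
      simp only [ne_eq, Subtype.mk.injEq] at hxa hxb
      have hxP : x ∈ P := ((h1 x).2 (not_or.2 ⟨hxa, hxb⟩)).resolve_right hxQ
      obtain ⟨y, hy⟩ := hQne
      have hxy : x ≠ y := fun h => hxQ (h ▸ hy)
      obtain ⟨G, H, hG, hH, hGne, hHne, hGH, hGHu⟩ := exists_isOpen_of_not_isPreconnected
        (toFinite {x, y}).isClosed.isOpen_compl (hpair x y hxy)
      have key : ∀ G H : Set X, IsOpen G → IsOpen H → H.Nonempty → Disjoint G H →
          G ∪ H = {x, y}ᶜ → a ∈ G → b ∉ G := by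
        intro G H hG hH hHne hGH hGHu ha hb
        have d1 := disjoint_of_cutPairs (hcut x) hP hQ hG hH hPQ hPQu hGH hGHu ha hb hy
        have d2 := disjoint_of_cutPairs (hcut y) hQ hP hG hH hPQ.symm (by rw [union_comm, hPQu])
          hGH (by rw [hGHu, pair_comm]) ha hb hxP
        obtain ⟨z, hz⟩ := hHne
        have hzP := Set.disjoint_left.1 d1 hz
        have hzQ := Set.disjoint_left.1 d2 hz
        have : z = a ∨ z = b := by
          by_contra h
          exact ((h1 z).2 h).elim hzP hzQ
        rcases this with rfl | rfl
        · exact Set.disjoint_left.1 hGH ha hz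
        · exact Set.disjoint_left.1 hGH hb hz
      have main : ∀ G H : Set X, IsOpen G → IsOpen H → H.Nonempty → Disjoint G H →
          G ∪ H = {x, y}ᶜ → a ∈ G → ∃ G' H' : Set ↥Qᶜ, IsOpen G' ∧ IsOpen H' ∧
            ⟨a, haQ⟩ ∈ G' ∧ ⟨b, hbQ⟩ ∈ H' ∧ Disjoint G' H' ∧ G' ∪ H' = {⟨x, hxQ⟩}ᶜ := by
        intro G H hG hH hHne hGH hGHu ha
        have h2 := fun z => Set.ext_iff.1 hGHu z
        simp only [mem_union, mem_compl_iff, mem_insert_iff, mem_singleton_iff] at h2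
        refine ⟨Subtype.val ⁻¹' G, Subtype.val ⁻¹' H, hG.preimage continuous_subtype_val,
          hH.preimage continuous_subtype_val, ha, ?_, hGH.preimage _, ?_⟩
        · refine ((h2 b).2 (not_or.2 ⟨fun h => hxb h.symm, fun h => hbQ (h ▸ hy)⟩)).resolve_left ?_
          exact key G H hG hH hHne hGH hGHu ha
        · ext ⟨z, hz⟩
          simp only [mem_union, mem_preimage, h2, mem_compl_iff, mem_singleton_iff,
            Subtype.mk.injEq, not_or, and_iff_left_iff_imp]
          rintro - rfl
          exact hz hy
      have h2 := fun z => Set.ext_iff.1 hGHu z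
      simp only [mem_union, mem_compl_iff, mem_insert_iff, mem_singleton_iff] at h2
      rcases (h2 a).2 (not_or.2 ⟨fun h => hxa h.symm, fun h => haQ (h ▸ hy)⟩) with ha | ha
      · exact main G H hG hH hHne hGH hGHu ha
      · exact main H G hH hG hGne hGH.symm (by rw [union_comm, hGHu]) ha)
  exact ⟨e, fun _ => hea, fun _ => heb⟩

open Real in
/-- A metric continuum without cut points, any two points of which form a cut pair, is a simple
closed curve. -/
theorem exists_homeomorph_circle_of_cutPairs {X : Type*} [MetricSpace X] [CompactSpace X]
    [Nontrivial X] (hcut : ∀ x : X, IsPreconnected ({x}ᶜ : Set X))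
    (hpair : ∀ x y : X, x ≠ y → ¬ IsPreconnected ({x, y}ᶜ : Set X)) : Nonempty (X ≃ₜ Circle) := by
  obtain ⟨a, b, hab⟩ := exists_pair_ne X
  obtain ⟨P, Q, hP, hQ, hPne, hQne, hPQ, hPQu⟩ := exists_isOpen_of_not_isPreconnected
    (toFinite {a, b}).isClosed.isOpen_compl (hpair a b hab)
  obtain ⟨e, hea, heb⟩ :=
    exists_homeomorph_unitInterval_of_cutPair hcut hpair hab hP hQ hPne hQne hPQ hPQu
  obtain ⟨f, hfa, hfb⟩ := exists_homeomorph_unitInterval_of_cutPair hcut hpair hab hQ hP hQne hPne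
    hPQ.symm (by rw [union_comm, hPQu])
  have h1 := fun z => Set.ext_iff.1 hPQu z
  simp only [mem_union, mem_compl_iff, mem_insert_iff, mem_singleton_iff] at h1
  have haQ : a ∈ Qᶜ := fun h => (h1 a).1 (Or.inr h) (Or.inl rfl)
  have hbQ : b ∈ Qᶜ := fun h => (h1 b).1 (Or.inr h) (Or.inr rfl)
  have haP : a ∈ Pᶜ := fun h => (h1 a).1 (Or.inl h) (Or.inl rfl)
  have hbP : b ∈ Pᶜ := fun h => (h1 b).1 (Or.inl h) (Or.inr rfl)
  have hQP : ∀ z, z ∈ Q → z ∈ Pᶜ := fun z hz hzP => Set.disjoint_left.1 hPQ hzP hz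
  classical
  let g : X → Circle := fun z =>
    if hz : z ∈ Q then Circle.exp (-(π * f ⟨z, hQP z hz⟩)) else Circle.exp (π * e ⟨z, hz⟩)
  have hgQ : ∀ z (hz : z ∈ Qᶜ), g z = Circle.exp (π * e ⟨z, hz⟩) := fun z hz => dif_neg hz
  have hgP : ∀ z (hz : z ∈ Pᶜ), g z = Circle.exp (-(π * f ⟨z, hz⟩)) := by
    intro z hz
    by_cases hzQ : z ∈ Q
    · exact dif_pos hzQ
    · rw [hgQ z hzQ, Circle.exp_eq_exp]
      have : z = a ∨ z = b := by
        by_contra h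
        exact ((h1 z).2 h).elim hz hzQ
      rcases this with rfl | rfl
      · exact ⟨0, by simp [hea, hfa]⟩
      · refine ⟨1, ?_⟩
        simp only [heb, hfb, Icc.coe_one, Int.cast_one]
        ring
  have hgc : Continuous g := by
    have hcov : Qᶜ ∪ Pᶜ = univ := by
      rw [← compl_inter, inter_comm, hPQ.inter_eq, compl_empty]
    rw [← continuousOn_univ, ← hcov]
    refine ContinuousOn.union_of_isClosed ?_ ?_ hQ.isClosed_compl hP.isClosed_compl
    · rw [continuousOn_iff_continuous_domRestrict]
      refine Continuous.congr (f := fun z : ↥Qᶜ => Circle.exp (π * e z)) ?_ fun z =>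
        (hgQ z z.2).symm
      fun_prop
    · rw [continuousOn_iff_continuous_domRestrict]
      refine Continuous.congr (f := fun z : ↥Pᶜ => Circle.exp (-(π * f z))) ?_ fun z =>
        (hgP z z.2).symm
      fun_prop
  have hpi := Real.pi_pos
  have hmix : ∀ z w, z ∈ Qᶜ → w ∈ Q → g z ≠ g w := by
    intro z w hz hw h
    rw [hgQ z hz, hgP w (hQP w hw), Circle.exp_eq_exp] at h
    obtain ⟨m, hm⟩ := h
    have hs := (e ⟨z, hz⟩).2
    have ht := (f ⟨w, hQP w hw⟩).2
    have hm' : ((e ⟨z, hz⟩ : ℝ)) + f ⟨w, hQP w hw⟩ = 2 * m := by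
      have : π * ((e ⟨z, hz⟩ : ℝ) + f ⟨w, hQP w hw⟩) = π * (2 * m) := by linarith
      exact mul_left_cancel₀ hpi.ne' this
    have hm0 : (-1 : ℝ) < m := by linarith [hs.1, ht.1]
    have hm2 : (m : ℝ) < 2 := by linarith [hs.2, ht.2]
    have hm01 : m = 0 ∨ m = 1 := by
      have h3 : (-1 : ℤ) < m := by exact_mod_cast hm0
      have h4 : m < (2 : ℤ) := by exact_mod_cast hm2
      omega
    rcases hm01 with rfl | rfl
    · have : f ⟨w, hQP w hw⟩ = f ⟨a, haP⟩ := by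
        rw [hfa]
        ext
        push_cast at hm' ⊢
        linarith [hs.1, ht.1]
      have hwa : w = a := congrArg Subtype.val (f.injective this)
      exact haQ (hwa ▸ hw)
    · have : f ⟨w, hQP w hw⟩ = f ⟨b, hbP⟩ := by
        rw [hfb]
        ext
        push_cast at hm' ⊢
        linarith [hs.2, ht.2]
      have hwb : w = b := congrArg Subtype.val (f.injective this)
      exact hbQ (hwb ▸ hw)
  have hexp : ∀ s t : ℝ, s ∈ Icc (0 : ℝ) 1 → t ∈ Icc (0 : ℝ) 1 →
      Circle.exp (π * s) = Circle.exp (π * t) → s = t := by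
    intro s t hs ht h
    have h3 := congrArg (fun z : Circle => Complex.arg z) h
    rw [Circle.arg_exp (by nlinarith [hs.1]) (by nlinarith [hs.2]),
      Circle.arg_exp (by nlinarith [ht.1]) (by nlinarith [ht.2])] at h3
    exact mul_left_cancel₀ hpi.ne' h3
  have hgi : Function.Injective g := by
    intro z w hzw
    by_cases hz : z ∈ Q <;> by_cases hw : w ∈ Q
    · rw [hgP z (hQP z hz), hgP w (hQP w hw), Circle.exp_neg, Circle.exp_neg, inv_inj] at hzw
      exact congrArg Subtype.val (f.injective (Subtype.ext (hexp _ _ (f _).2 (f _).2 hzw)))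
    · exact (hmix w z hw hz hzw.symm).elim
    · exact (hmix z w hz hw hzw).elim
    · rw [hgQ z hz, hgQ w hw] at hzw
      exact congrArg Subtype.val (e.injective (Subtype.ext (hexp _ _ (e _).2 (e _).2 hzw)))
  have hgs : Function.Surjective g := by
    intro w
    have h3 := Complex.neg_pi_lt_arg (w : ℂ)
    have h4 := Complex.arg_le_pi (w : ℂ)
    rcases le_or_gt 0 (Complex.arg w) with h | h
    · refine ⟨e.symm ⟨Complex.arg w / π, by positivity, (div_le_one hpi).2 h4⟩, ?_⟩
      rw [hgQ _ (Subtype.coe_prop _), Subtype.coe_eta, e.apply_symm_apply,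
        mul_div_cancel₀ _ hpi.ne', Circle.exp_arg]
    · refine ⟨f.symm ⟨-Complex.arg w / π, div_nonneg (by linarith) hpi.le,
        (div_le_one hpi).2 (by linarith)⟩, ?_⟩
      rw [hgP _ (Subtype.coe_prop _), Subtype.coe_eta, f.apply_symm_apply,
        mul_div_cancel₀ _ hpi.ne', neg_neg, Circle.exp_arg]
  exact ⟨hgc.homeoOfEquivCompactToT2 (f := Equiv.ofBijective g ⟨hgi, hgs⟩)⟩

end CircleCase

section Hyperspace

variable {X : Type*} [MetricSpace X]

theorem isCompact_setOf_NCstar [CompactSpace (NCstar X)] :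
    IsCompact {A : NonemptyCompacts X | IsConnected (A : Set X) ∧ IsPreconnected (A : Set X)ᶜ} :=
  isCompact_iff_compactSpace.2 ‹_›

/-- The union of the nonseparating continua inside a closed set is closed, if the nonseparating
continua form a compact family. -/
theorem isClosed_sUnion_isNonseparatingContinuum [CompactSpace X]
    [CompactSpace (NCstar X)] (F : Set X)
    (hF : IsClosed F) : IsClosed (⋃₀ {A | IsNonseparatingContinuum A ∧ A ⊆ F}) := by
  have h := (NonemptyCompacts.isCompact_biUnion_coe_of_isCompact
    ((isCompact_setOf_NCstar (X := X)).inter_right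
      (NonemptyCompacts.isClosed_subsets_of_isClosed hF))).isClosed
  convert h using 1
  ext x
  simp only [mem_sUnion, mem_ofPred_eq, mem_iUnion, mem_inter_iff, exists_prop, SetLike.mem_coe]
  constructor
  · rintro ⟨A, ⟨hA, hAF⟩, hx⟩
    exact ⟨⟨⟨A, hA.isClosed.isCompact⟩, hA.isConnected.nonempty⟩,
      ⟨⟨hA.isConnected, hA.isPreconnected_compl⟩, hAF⟩, hx⟩
  · rintro ⟨A, ⟨⟨h1, h2⟩, hAF⟩, hx⟩
    exact ⟨A, ⟨⟨A.isCompact.isClosed, h1, h2⟩, hAF⟩, hx⟩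

/-- If the nonseparating continua form a compact family, then a chain of sets contained in
nonseparating continua inside a closed set `F` has its union contained in such a continuum. -/
theorem exists_isNonseparatingContinuum_sUnion_subset [CompactSpace X]
    [CompactSpace (NCstar X)] (F : Set X) (c : Set (Set X)) (hF : IsClosed F)
    (hc : IsChain (· ⊆ ·) c) (hne : c.Nonempty)
    (h : ∀ K ∈ c, ∃ B, IsNonseparatingContinuum B ∧ K ⊆ B ∧ B ⊆ F) :
    ∃ B, IsNonseparatingContinuum B ∧ ⋃₀ c ⊆ B ∧ B ⊆ F := by
  have : Nonempty c := hne.to_subtype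
  have hcl : ∀ K : Set X, IsClosed {B : NonemptyCompacts X | K ⊆ B} := by
    intro K
    have : {B : NonemptyCompacts X | K ⊆ B} =
        ⋂ x ∈ K, {B : NonemptyCompacts X | ((B : Set X) ∩ {x}).Nonempty} := by
      ext B
      simp [subset_def]
    rw [this]
    exact isClosed_biInter fun x _ =>
      NonemptyCompacts.isClosed_inter_nonempty_of_isClosed isClosed_singleton
  let S : c → Set (NonemptyCompacts X) := fun K =>
    ({A : NonemptyCompacts X | IsConnected (A : Set X) ∧ IsPreconnected (A : Set X)ᶜ} ∩
      {A : NonemptyCompacts X | (A : Set X) ⊆ F}) ∩ {B : NonemptyCompacts X | K.1 ⊆ B}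
  have hcpt : ∀ K, IsCompact (S K) := fun K => (isCompact_setOf_NCstar.inter_right
    (NonemptyCompacts.isClosed_subsets_of_isClosed hF)).inter_right (hcl K)
  have hdir : Directed (· ⊇ ·) S := by
    rintro ⟨A, hA⟩ ⟨B, hB⟩
    rcases hc.total hA hB with h | h
    · exact ⟨⟨B, hB⟩, fun D hD => ⟨hD.1, h.trans hD.2⟩, subset_rfl⟩
    · exact ⟨⟨A, hA⟩, subset_rfl, fun D hD => ⟨hD.1, h.trans hD.2⟩⟩
  obtain ⟨B, hB⟩ := IsCompact.nonempty_iInter_of_directed_nonempty_isCompact_isClosed S hdir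
    (fun K => by
      obtain ⟨B, hB, hKB, hBF⟩ := h K K.2
      exact ⟨⟨⟨B, hB.isClosed.isCompact⟩, hB.isConnected.nonempty⟩,
        ⟨⟨hB.isConnected, hB.isPreconnected_compl⟩, hBF⟩, hKB⟩) hcpt fun K => (hcpt K).isClosed
  rw [mem_iInter] at hB
  obtain ⟨K, hK⟩ := hne
  obtain ⟨⟨⟨h1, h2⟩, hBF⟩, -⟩ := hB ⟨K, hK⟩
  exact ⟨B, ⟨B.isCompact.isClosed, h1, h2⟩, sUnion_subset fun K hK => (hB ⟨K, hK⟩).2, hBF⟩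

/-- If the nonseparating subcontinua of a space homeomorphic to `X` are parametrised by a compact
connected space, then `NCstar X` is compact and connected. -/
theorem compactSpace_connectedSpace_NCstar {T Y : Type*} [TopologicalSpace T] [CompactSpace T]
    [ConnectedSpace T] [TopologicalSpace Y] (e : X ≃ₜ Y) {F : T → NonemptyCompacts Y}
    (hF : Continuous F)
    (hmem : ∀ t, IsConnected (F t : Set Y) ∧ IsPreconnected (F t : Set Y)ᶜ)
    (hsurj : ∀ A : NonemptyCompacts Y, IsConnected (A : Set Y) → IsPreconnected (A : Set Y)ᶜ →
      ∃ t, (F t : Set Y) = A) : CompactSpace (NCstar X) ∧ ConnectedSpace (NCstar X) := by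
  let G : T → NCstar X := fun t => ⟨(F t).map e.symm e.symm.continuous, by
    rw [NonemptyCompacts.coe_map, ← image_compl_eq e.symm.bijective]
    exact ⟨(hmem t).1.image _ e.symm.continuous.continuousOn,
      (hmem t).2.image _ e.symm.continuous.continuousOn⟩⟩
  have hG : Continuous G := (e.symm.continuous.nonemptyCompacts_map.comp hF).subtype_mk _
  have hGs : Function.Surjective G := by
    rintro ⟨A, hA, hA'⟩
    obtain ⟨t, ht⟩ := hsurj (A.map e e.continuous)
      (by
        rw [NonemptyCompacts.coe_map]
        exact hA.image _ e.continuous.continuousOn)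
      (by
        rw [NonemptyCompacts.coe_map, ← image_compl_eq e.bijective]
        exact hA'.image _ e.continuous.continuousOn)
    refine ⟨t, Subtype.ext (SetLike.coe_injective ?_)⟩
    simp only [G]
    rw [NonemptyCompacts.coe_map, ht, NonemptyCompacts.coe_map, ← image_comp]
    simp
  exact ⟨hGs.compactSpace hG, hGs.connectedSpace hG⟩

theorem compactSpace_connectedSpace_NCstar_of_homeomorph_unitInterval (e : X ≃ₜ unitInterval) :
    CompactSpace (NCstar X) ∧ ConnectedSpace (NCstar X) := by
  let l : unitInterval → unitInterval := fun u => projIcc 0 1 zero_le_one (2 * u - 1)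
  let r : unitInterval → unitInterval := fun u => projIcc 0 1 zero_le_one (2 * u)
  have hl : Continuous l := continuous_projIcc.comp (by fun_prop)
  have hr : Continuous r := continuous_projIcc.comp (by fun_prop)
  have hlr : ∀ u, l u ≤ r u := fun u => monotone_projIcc _ (by linarith)
  have hends : ∀ u : unitInterval, l u = 0 ∨ r u = 1 := by
    intro u
    rcases le_total (2 * (u : ℝ)) 1 with h | h
    · exact Or.inl (projIcc_of_le_left _ (by linarith))
    · exact Or.inr (projIcc_of_right_le _ h)
  let F : unitInterval → NonemptyCompacts unitInterval := fun u =>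
    (⊤ : NonemptyCompacts unitInterval).map (fun s => max (l u) (min s (r u))) (by fun_prop)
  have hFc : Continuous F := continuous_const.nonemptyCompacts_map' (by
    simp only [Function.uncurry_def]
    fun_prop)
  have hF : ∀ u, (F u : Set unitInterval) = Icc (l u) (r u) := by
    intro u
    simp only [F]
    rw [NonemptyCompacts.coe_map, NonemptyCompacts.coe_top, image_univ]
    ext s
    constructor
    · rintro ⟨s, rfl⟩
      exact ⟨le_max_left _ _, max_le (hlr u) (min_le_right _ _)⟩
    · rintro ⟨h1, h2⟩
      exact ⟨s, by simp only [min_eq_left h2, max_eq_right h1]⟩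
  refine compactSpace_connectedSpace_NCstar e hFc (fun u => ?_) fun A hA hA' => ?_
  · rw [hF]
    refine ⟨⟨nonempty_Icc.2 (hlr u), isPreconnected_Icc⟩, ?_⟩
    rcases hends u with h | h
    · have : (Icc (l u) (r u))ᶜ = Ioi (r u) := by
        ext s
        simp [h]
      rw [this]
      exact isPreconnected_Ioi
    · have : (Icc (l u) (r u))ᶜ = Iio (l u) := by
        ext s
        simp [h, unitInterval.le_one']
      rw [this]
      exact isPreconnected_Iio
  · have hAI := eq_Icc_of_connected_compact hA A.isCompact
    set m := sInf (A : Set unitInterval)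
    set M := sSup (A : Set unitInterval)
    have hmM : m ≤ M := by
      have := hA.nonempty
      rw [hAI] at this
      exact nonempty_Icc.1 this
    have hcase : m = 0 ∨ M = 1 := by
      by_contra! h
      have h0 : (0 : unitInterval) ∈ (A : Set unitInterval)ᶜ := by
        rw [hAI]
        exact fun h' => h.1 (le_antisymm h'.1 unitInterval.nonneg')
      have h1 : (1 : unitInterval) ∈ (A : Set unitInterval)ᶜ := by
        rw [hAI]
        exact fun h' => h.2 (le_antisymm unitInterval.le_one' h'.2)
      have hm : m ∈ (A : Set unitInterval) := by
        rw [hAI]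
        exact ⟨le_rfl, hmM⟩
      exact hA'.ordConnected.out h0 h1 ⟨unitInterval.nonneg', unitInterval.le_one'⟩ hm
    have hm := m.2
    have hM := M.2
    rcases hcase with h | h
    · refine ⟨⟨(M : ℝ) / 2, by linarith [hM.1], by linarith [hM.2]⟩, ?_⟩
      rw [hF, hAI, h]
      congr 1
      · exact projIcc_of_le_left _ (by simp only; linarith [hM.2])
      · simp only [r, mul_div_cancel₀ _ (two_ne_zero' ℝ)]
        exact projIcc_val _ _
    · refine ⟨⟨((m : ℝ) + 1) / 2, by linarith [hm.1], by linarith [hm.2]⟩, ?_⟩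
      rw [hF, hAI, h]
      congr 1
      · simp only [l, mul_div_cancel₀ _ (two_ne_zero' ℝ), add_sub_cancel_right]
        exact projIcc_val _ _
      · exact projIcc_of_right_le _ (by simp only; linarith [hm.1])

open Real in
theorem compactSpace_connectedSpace_NCstar_of_homeomorph_circle (e : X ≃ₜ Circle) :
    CompactSpace (NCstar X) ∧ ConnectedSpace (NCstar X) := by
  let φ : Circle × unitInterval → unitInterval → Circle := fun p s =>
    p.1 * Circle.exp (2 * π * (p.2 * s))
  have hφ : Continuous φ.uncurry := by
    simp only [Function.uncurry_def, φ]
    fun_prop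
  let F : Circle × unitInterval → NonemptyCompacts Circle := fun p =>
    (⊤ : NonemptyCompacts unitInterval).map (φ p) (by fun_prop)
  have hFc : Continuous F := continuous_const.nonemptyCompacts_map' hφ
  have hF : ∀ p, (F p : Set Circle) = range (φ p) := by
    intro p
    simp only [F]
    rw [NonemptyCompacts.coe_map, NonemptyCompacts.coe_top, image_univ]
  have hpi := Real.pi_pos
  refine compactSpace_connectedSpace_NCstar e hFc (fun p => ?_) fun A hA _ => ?_
  · rw [hF]
    refine ⟨isConnected_range (by fun_prop), ?_⟩
    obtain ⟨w, t⟩ := p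
    have : (range (φ (w, t)))ᶜ = (fun θ : ℝ => w * Circle.exp (2 * π * θ)) '' Ioo (t : ℝ) 1 := by
      ext z
      constructor
      · intro hz
        obtain ⟨α, hα⟩ := Circle.exp_surjective (z / w)
        have hfr : Circle.exp (2 * π * Int.fract (α / (2 * π))) = z / w := by
          rw [← hα, Circle.exp_eq_exp]
          refine ⟨-⌊α / (2 * π)⌋, ?_⟩
          rw [Int.fract]
          push_cast
          field_simp
          ring
        refine ⟨Int.fract (α / (2 * π)), ⟨?_, Int.fract_lt_one _⟩, ?_⟩
        · by_contra! hle
          have h0 := Int.fract_nonneg (α / (2 * π))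
          refine hz ⟨⟨Int.fract (α / (2 * π)) / t, div_nonneg h0 t.2.1,
            div_le_one_of_le₀ hle t.2.1⟩, ?_⟩
          have : (t : ℝ) * (Int.fract (α / (2 * π)) / t) = Int.fract (α / (2 * π)) := by
            rcases eq_or_ne (t : ℝ) 0 with h | h
            · rw [h] at hle ⊢
              linarith
            · exact mul_div_cancel₀ _ h
          simp only [φ, this, hfr]
          exact mul_div_cancel w z
        · simp only [hfr]
          exact mul_div_cancel w z
      · rintro ⟨θ, ⟨hθ1, hθ2⟩, rfl⟩ ⟨s, hs⟩
        simp only [φ] at hs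
        rw [mul_right_inj, Circle.exp_eq_exp] at hs
        obtain ⟨m, hm⟩ := hs
        have hm' : (t : ℝ) * s = θ + m := by
          have : 2 * π * ((t : ℝ) * s) = 2 * π * (θ + m) := by linarith
          exact mul_left_cancel₀ (by positivity) this
        have h0 : 0 ≤ (t : ℝ) * s := mul_nonneg t.2.1 s.2.1
        have h1 : (t : ℝ) * s ≤ t := mul_le_of_le_one_right t.2.1 s.2.2
        have h2 : (-1 : ℤ) < m := by
          have : (-1 : ℝ) < m := by linarith
          exact_mod_cast this
        have h3 : m < (0 : ℤ) := by
          have : (m : ℝ) < 0 := by linarith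
          exact_mod_cast this
        omega
    rw [this]
    exact isPreconnected_Ioo.image _ (by fun_prop)
  · by_cases hAu : (A : Set Circle) = univ
    · refine ⟨(1, 1), ?_⟩
      rw [hF, hAu]
      refine eq_univ_of_forall fun z => ?_
      obtain ⟨α, hα⟩ := Circle.exp_surjective z
      refine ⟨⟨Int.fract (α / (2 * π)), Int.fract_nonneg _, (Int.fract_lt_one _).le⟩, ?_⟩
      simp only [φ, one_mul, Icc.coe_one]
      rw [← hα, Circle.exp_eq_exp]
      refine ⟨-⌊α / (2 * π)⌋, ?_⟩
      rw [Int.fract]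
      push_cast
      field_simp
      ring
    · obtain ⟨v, hv⟩ := (ne_univ_iff_exists_notMem _).1 hAu
      set u := v / Circle.exp π
      have hcont : ContinuousOn (fun z : Circle => Complex.arg (z / u : Circle)) A := by
        intro z hz
        refine ContinuousAt.continuousWithinAt ?_
        have hs : ((z / u : Circle) : ℂ) ∈ Complex.slitPlane := by
          rw [Complex.mem_slitPlane_iff_arg]
          refine ⟨fun h => hv ?_, Circle.coe_ne_zero _⟩
          have : Circle.exp π = z / u := by rw [← h, Circle.exp_arg]
          have hvz : v = z := by
            rw [eq_div_iff_mul_eq', mul_comm] at this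
            rw [← this]
            simp [u]
          exact hvz ▸ hz
        exact (Complex.continuousAt_arg hs).comp (f := fun z : Circle => ((z / u : Circle) : ℂ))
          (by fun_prop)
      have himg := eq_Icc_of_connected_compact (hA.image _ hcont)
        (A.isCompact.image_of_continuousOn hcont)
      set c := sInf ((fun z : Circle => Complex.arg (z / u : Circle)) '' A)
      set d := sSup ((fun z : Circle => Complex.arg (z / u : Circle)) '' A)
      have hcd : c ≤ d := by
        have := hA.nonempty.image fun z : Circle => Complex.arg (z / u : Circle)
        rw [himg] at this
        exact nonempty_Icc.1 this
      have hmemA : ∀ z : Circle, z ∈ (A : Set Circle) ↔ ∃ θ ∈ Icc c d, u * Circle.exp θ = z := by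
        intro z
        rw [← himg]
        constructor
        · intro hz
          exact ⟨_, ⟨z, hz, rfl⟩, by rw [Circle.exp_arg, mul_div_cancel]⟩
        · rintro ⟨_, ⟨z', hz', rfl⟩, rfl⟩
          rwa [Circle.exp_arg, mul_div_cancel]
      have hc : -π < c := by
        obtain ⟨z, -, hz⟩ := (himg.symm ▸ left_mem_Icc.2 hcd :
          c ∈ (fun z : Circle => Complex.arg (z / u : Circle)) '' A)
        rw [← hz]
        exact Complex.neg_pi_lt_arg _
      have hd : d ≤ π := by
        obtain ⟨z, -, hz⟩ := (himg.symm ▸ right_mem_Icc.2 hcd :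
          d ∈ (fun z : Circle => Complex.arg (z / u : Circle)) '' A)
        rw [← hz]
        exact Complex.arg_le_pi _
      refine ⟨(u * Circle.exp c, ⟨(d - c) / (2 * π), div_nonneg (by linarith) (by linarith),
        (div_le_one (by linarith)).2 (by linarith)⟩), ?_⟩
      rw [hF]
      have hφs : ∀ s : unitInterval, φ (u * Circle.exp c, ⟨(d - c) / (2 * π),
          div_nonneg (by linarith) (by linarith), (div_le_one (by linarith)).2 (by linarith)⟩) s =
          u * Circle.exp (c + (d - c) * s) := by
        intro s
        simp only [φ]
        rw [mul_assoc, ← Circle.exp_add]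
        congr 3
        field_simp
      ext z
      rw [hmemA]
      constructor
      · rintro ⟨s, rfl⟩
        refine ⟨c + (d - c) * s, ⟨?_, ?_⟩, (hφs s).symm⟩
        · linarith [mul_nonneg (sub_nonneg.2 hcd) s.2.1]
        · linarith [mul_le_of_le_one_right (sub_nonneg.2 hcd) s.2.2]
      · rintro ⟨θ, ⟨h1, h2⟩, rfl⟩
        refine ⟨⟨(θ - c) / (d - c), div_nonneg (by linarith) (by linarith),
          div_le_one_of_le₀ (by linarith) (by linarith)⟩, ?_⟩
        rw [hφs]
        congr 2
        rcases hcd.eq_or_lt with h | h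
        · simp only [h, sub_self, zero_mul, add_zero]
          linarith
        · simp only [mul_div_cancel₀ _ (sub_pos.2 h).ne']
          ring

end Hyperspace

/-- For a locally connected continuum X, NC*(X) is compact and connected
iff X is homeomorphic to an arc or a simple closed curve. -/
theorem stmt1 {X : Type*} [MetricSpace X] [CompactSpace X] [ConnectedSpace X] [Nontrivial X]
    [LocallyConnectedSpace X] :
    (CompactSpace (NCstar X) ∧ ConnectedSpace (NCstar X)) ↔
      (Nonempty (X ≃ₜ unitInterval) ∨ Nonempty (X ≃ₜ Circle)) := by
  constructor
  · rintro ⟨h, -⟩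
    by_cases hcut : ∀ x : X, IsPreconnected ({x}ᶜ : Set X)
    · exact Or.inr (exists_homeomorph_circle_of_cutPairs hcut fun x y hxy =>
        not_isPreconnected_compl_pair exists_isNonseparatingContinuum_sUnion_subset hcut hxy)
    · obtain ⟨p, hp⟩ := not_forall.1 hcut
      exact Or.inl (exists_homeomorph_unitInterval_of_cutPoint
        isClosed_sUnion_isNonseparatingContinuum hp)
  · rintro (⟨⟨e⟩⟩ | ⟨⟨e⟩⟩)
    · exact compactSpace_connectedSpace_NCstar_of_homeomorph_unitInterval e
    · exact compactSpace_connectedSpace_NCstar_of_homeomorph_circle e
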